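/- arXiv:2407.08771 — 5 statements merged into one kernel-verified Lean document; each statement's English description precedes it below -/
import Mathlib

section
/- For every (2,1)-type 3-graph F with π_⸫(F) = 0 and every real ε > 0, there exists an integer m with the following property: if H is a (2,1)-type 3-graph with vertex partition U ∪ V (each edge having two vertices in U and one in V), each part of size at least m, and d_H(u_1,u_2) ≥ ε|V| for every pair of distinct u_1, u_2 ∈ U, then H contains a copy of F. -/
open Finset

structure ThreeGraph (V : Type*) where
  edges : Finset (Finset V)
  card_eq : ∀ e ∈ edges, e.card = 3

variable {α β : Type*}

/-- `H` contains a copy of `F`. -/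
def HasCopy [DecidableEq β] (H : ThreeGraph β) (F : ThreeGraph α) : Prop :=
  ∃ φ : α → β, Function.Injective φ ∧ ∀ e ∈ F.edges, e.image φ ∈ H.edges

/-- The codegree of a pair of vertices. -/
def codeg [DecidableEq β] [Fintype β] (H : ThreeGraph β) (u v : β) : ℕ :=
  (Finset.univ.filter (fun w => ({u, v, w} : Finset β) ∈ H.edges)).card

/-- The codegree Turán density of a 3-graph `F`. -/
noncomputable def piCo (F : ThreeGraph α) : ℝ :=
  sSup {x : ℝ | 0 ≤ x ∧ x ≤ 1 ∧ ∀ n₀ : ℕ, ∃ n : ℕ, n₀ ≤ n ∧ ∃ H : ThreeGraph (Fin n),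
    ¬ HasCopy H F ∧ ∀ u v : Fin n, u ≠ v → x * n ≤ (codeg H u v : ℝ)}

/-- An `n`-vertex 3-graph is uniformly `(d, η)`-dense. -/
def UniformlyDense {n : ℕ} (H : ThreeGraph (Fin n)) (d η : ℝ) : Prop :=
  ∀ U : Finset (Fin n),
    d * (U.card.choose 3 : ℝ) - η * (n : ℝ) ^ 3 ≤ ((H.edges.filter (fun e => e ⊆ U)).card : ℝ)

/-- The uniform Turán density of a 3-graph `F`. -/
noncomputable def piUnif (F : ThreeGraph α) : ℝ :=
  sSup {d : ℝ | 0 ≤ d ∧ d ≤ 1 ∧ ∀ η : ℝ, 0 < η → ∀ n₀ : ℕ, ∃ n : ℕ, n₀ ≤ n ∧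
    ∃ H : ThreeGraph (Fin n), ¬ HasCopy H F ∧ UniformlyDense H d η}

/-- `f` is a layered function of the 3-graph with edge set `E`. -/
def IsLayeredFunction [DecidableEq α] (E : Finset (Finset α)) (f : α → ℕ) : Prop :=
  (∀ e ∈ E, ∃ w ∈ e, ∀ u ∈ e, u ≠ w → f u < f w) ∧
  (∀ e₁ ∈ E, ∀ e₂ ∈ E, e₁.sup f = e₂.sup f → Multiset.map f e₁.val = Multiset.map f e₂.val) ∧
  (∀ e₁ ∈ E, ∀ e₂ ∈ E, ∀ u v w u' v' w' : α,
    u ≠ v → u ≠ w → v ≠ w → u' ≠ v' → u' ≠ w' → v' ≠ w' →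
    e₁ = {u, v, w} → e₂ = {u', v', w'} →
    f u = f u' → f v = f v' → f w = f w')

/-- A 3-graph is layered if it admits a layered function. -/
def IsLayered [DecidableEq α] (F : ThreeGraph α) : Prop :=
  ∃ f : α → ℕ, IsLayeredFunction F.edges f

/-! ### Ultrafilters on sequences that are invariant under strictly increasing reindexing -/

/-- Prepend a value to a sequence. -/
def seqCons (i : ℕ) (σ : ℕ → ℕ) : ℕ → ℕ
  | 0 => i
  | n + 1 => σ n

/-- The `k`-fold ordered product of the hyperfilter, extended by zeros to full sequences. -/
noncomputable def iterHyper : ℕ → Ultrafilter (ℕ → ℕ)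
  | 0 => pure fun _ => 0
  | k + 1 => (Filter.hyperfilter ℕ).bind fun i => (iterHyper k).map (seqCons i)

theorem eventually_iterHyper_succ (k : ℕ) (R : (ℕ → ℕ) → Prop) :
    (∀ᶠ σ in (iterHyper (k + 1) : Filter (ℕ → ℕ)), R σ) ↔
      ∀ᶠ i in (Filter.hyperfilter ℕ : Filter ℕ),
        ∀ᶠ σ in (iterHyper k : Filter (ℕ → ℕ)), R (seqCons i σ) :=
  Iff.rfl

/-- `R` only depends on the first `k` terms of a sequence. -/
def DependsOnFirst (k : ℕ) (R : (ℕ → ℕ) → Prop) : Prop :=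
  ∀ σ τ : ℕ → ℕ, (∀ i < k, σ i = τ i) → (R σ ↔ R τ)

theorem eventually_iterHyper_comp (K : ℕ) : ∀ (k : ℕ) (θ : ℕ → ℕ) (R : (ℕ → ℕ) → Prop),
    StrictMono θ → θ k ≤ K → DependsOnFirst k R →
    ((∀ᶠ σ in (iterHyper K : Filter (ℕ → ℕ)), R (σ ∘ θ)) ↔
      ∀ᶠ σ in (iterHyper k : Filter (ℕ → ℕ)), R σ) := by
  induction K with
  | zero =>
    intro k θ R hθ hk hR
    have hk0 : k = 0 := by have := hθ.id_le k; simp at this; omega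
    subst hk0
    have hc : ∀ σ, R σ ↔ R (fun _ => 0) := fun σ => hR _ _ (by simp)
    simp only [hc (_ ∘ θ)]
    simp only [hc]
  | succ K ih =>
    intro k θ R hθ hk hR
    cases k with
    | zero =>
      have hc : ∀ σ, R σ ↔ R (fun _ => 0) := fun σ => hR _ _ (by simp)
      rw [Filter.eventually_congr (Filter.Eventually.of_forall fun σ => hc (σ ∘ θ)),
        Filter.eventually_congr (Filter.Eventually.of_forall fun σ => hc σ)]
      simp
    | succ k =>
      rw [eventually_iterHyper_succ]
      rcases Nat.eq_zero_or_pos (θ 0) with h0 | h0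
      · rw [eventually_iterHyper_succ]
        have hpos : ∀ j, 0 < θ (j + 1) := fun j =>
          (Nat.zero_le _).trans_lt (hθ (Nat.succ_pos j))
        have hcomp : ∀ i σ, seqCons i σ ∘ θ = seqCons i (σ ∘ fun j => θ (j + 1) - 1) := by
          intro i σ
          funext j
          cases j with
          | zero => simp [h0, seqCons]
          | succ j =>
            obtain ⟨l, hl⟩ := Nat.exists_eq_succ_of_ne_zero (hpos j).ne'
            simp [hl, seqCons]
        simp only [hcomp]
        refine Filter.eventually_congr (Filter.Eventually.of_forall fun i => ?_)
        refine ih k _ (fun σ => R (seqCons i σ)) ?_ (by omega) ?_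
        · intro a b hab
          have := hθ (Nat.succ_lt_succ hab)
          have := hpos a
          simp only
          simp only [Nat.succ_eq_add_one] at *
          omega
        · intro σ τ h
          refine hR _ _ fun j hj => ?_
          cases j with
          | zero => rfl
          | succ j => exact h j (by omega)
      · have hpos : ∀ j, 0 < θ j := fun j => h0.trans_le (hθ.monotone (Nat.zero_le j))
        have hcomp : ∀ i σ, seqCons i σ ∘ θ = σ ∘ fun j => θ j - 1 := by
          intro i σ
          funext j
          obtain ⟨l, hl⟩ := Nat.exists_eq_succ_of_ne_zero (hpos j).ne'
          simp [hl, seqCons]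
        simp only [hcomp]
        rw [Filter.eventually_const]
        refine ih (k + 1) _ R ?_ (by omega) hR
        intro a b hab
        have := hθ hab
        have := hpos a
        simp only
        omega

/-- An ultrafilter on sequences which is invariant under strictly increasing reindexing, as far
as properties of finitely many terms are concerned. -/
noncomputable def seqUltra : Ultrafilter (ℕ → ℕ) :=
  (Filter.hyperfilter ℕ).bind iterHyper

theorem eventually_seqUltra_comp {k : ℕ} {θ : ℕ → ℕ} {R : (ℕ → ℕ) → Prop}
    (hθ : StrictMono θ) (hR : DependsOnFirst k R) :
    (∀ᶠ σ in (seqUltra : Filter (ℕ → ℕ)), R (σ ∘ θ)) ↔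
      ∀ᶠ σ in (iterHyper k : Filter (ℕ → ℕ)), R σ := by
  change (∀ᶠ K in (Filter.hyperfilter ℕ : Filter ℕ),
    ∀ᶠ σ in (iterHyper K : Filter (ℕ → ℕ)), R (σ ∘ θ)) ↔ _
  have hK : ∀ᶠ K in (Filter.hyperfilter ℕ : Filter ℕ), θ k ≤ K :=
    Nat.hyperfilter_le_atTop (Filter.eventually_ge_atTop (θ k))
  rw [Filter.eventually_congr (hK.mono fun K h => eventually_iterHyper_comp K k θ R hθ h hR)]
  simp

theorem eventually_seqUltra {k : ℕ} {R : (ℕ → ℕ) → Prop} (hR : DependsOnFirst k R) :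
    (∀ᶠ σ in (seqUltra : Filter (ℕ → ℕ)), R σ) ↔
      ∀ᶠ σ in (iterHyper k : Filter (ℕ → ℕ)), R σ :=
  eventually_seqUltra_comp strictMono_id hR

theorem eventually_seqUltra_ne {a b : ℕ} (hab : a < b) :
    ∀ᶠ σ in (seqUltra : Filter (ℕ → ℕ)), σ a ≠ σ b := by
  let θ : ℕ → ℕ := fun i => if i = 0 then a else b + i - 1
  have hθ : StrictMono θ := by
    intro i j hij
    simp only [θ]
    split_ifs <;> omega
  have h := (eventually_seqUltra_comp (k := 2) (R := fun σ => σ 0 ≠ σ 1) hθ (by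
    intro σ τ h
    simp only [h 0 (by omega), h 1 (by omega)])).2 (by
      rw [eventually_iterHyper_succ]
      refine Filter.Eventually.of_forall fun i => ?_
      rw [eventually_iterHyper_succ]
      have hne : ∀ᶠ j in (Filter.hyperfilter ℕ : Filter ℕ), i < j :=
        Nat.hyperfilter_le_atTop (Filter.eventually_gt_atTop i)
      refine hne.mono fun j hj => Filter.Eventually.of_forall fun σ => ?_
      simp only [seqCons]
      exact hj.ne)
  simpa [θ] using h

/-! ### Moment functions of order-invariant systems of events -/

/-- `P S` behaves like the probability of the intersection of the events indexed by the pairs in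
`S`, for a system of events indexed by pairs of naturals whose joint distribution is invariant
under strictly increasing reindexing. -/
structure IsSpreadableMoment (P : Finset (ℕ × ℕ) → ℝ) : Prop where
  empty : P ∅ = 1
  anti : ∀ S T, S ⊆ T → P T ≤ P S
  psd : ∀ (s : Finset ℕ) (c : ℕ → ℝ) (S : ℕ → Finset (ℕ × ℕ)) (r : ℝ) (T : Finset (ℕ × ℕ)),
    0 ≤ ∑ i ∈ s, ∑ j ∈ s, c i * c j * P (S i ∪ S j) +
      2 * r * ∑ i ∈ s, c i * P (S i ∪ T) + r ^ 2 * P T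
  comp : ∀ (θ : ℕ → ℕ) (S : Finset (ℕ × ℕ)), StrictMono θ → P (S.image (Prod.map θ θ)) = P S

/-- The pairs `i < j < k` directed from a source letter to a sink letter of the word `X`. -/
def wordPairs (k : ℕ) (X : ℕ → Bool) : Finset (ℕ × ℕ) :=
  (range k ×ˢ range k).filter fun p => p.1 < p.2 ∧ X p.1 = true ∧ X p.2 = false

/-- Place letter `t` of a word at slot `s` of a gap of length `N + 1`. -/
def slotMap (t N s i : ℕ) : ℕ := if i < t then i else if i = t then t + s else i + N

/-- Place letters `t` and `t + 1` of a word at slots `s` and `s'` of a gap of length `N + 1`. -/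
def slotMapTwo (t N s s' i : ℕ) : ℕ :=
  if i < t then i else if i = t then t + s else if i = t + 1 then t + s' else i + N - 1

/-- Replace letter `t` of the word `X` by the two letters `a`, `b`. -/
def splitWord (t : ℕ) (a b : Bool) (X : ℕ → Bool) (i : ℕ) : Bool :=
  if i < t then X i else if i = t then a else if i = t + 1 then b else X (i - 1)

theorem strictMono_slotMap {t N s : ℕ} (hs : s ≤ N) : StrictMono (slotMap t N s) := by
  intro i j hij
  simp only [slotMap]
  split_ifs <;> omega

theorem strictMono_slotMapTwo {t N s s' : ℕ} (hs : s < s') (hs' : s' ≤ N) :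
    StrictMono (slotMapTwo t N s s') := by
  intro i j hij
  simp only [slotMapTwo]
  split_ifs <;> omega

/-- The pairs of the word obtained from `X` by setting letter `t` to `a`, with letter `t` placed
at slot `s`. -/
def slotPairs (k t N : ℕ) (X : ℕ → Bool) (a : Bool) (s : ℕ) : Finset (ℕ × ℕ) :=
  (wordPairs k (Function.update X t a)).image (Prod.map (slotMap t N s) (slotMap t N s))

/-- The pairs of the word obtained from `X` by replacing letter `t` by `a`, `b`, placed at slots
`s` and `s'`. -/
def slotPairsTwo (k t N : ℕ) (X : ℕ → Bool) (a b : Bool) (s s' : ℕ) : Finset (ℕ × ℕ) :=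
  (wordPairs (k + 1) (splitWord t a b X)).image
    (Prod.map (slotMapTwo t N s s') (slotMapTwo t N s s'))

theorem slotPairs_union_subset {k t N s s' : ℕ} {X : ℕ → Bool} {a b : Bool} (ht : t < k) :
    slotPairs k t N X a s ∪ slotPairs k t N X b s' ⊆ slotPairsTwo k t N X a b s s' := by
  intro p hp
  simp only [slotPairs, slotPairsTwo, wordPairs, mem_union, mem_image, mem_filter, mem_product,
    mem_range, Prod.exists, Prod.map_apply] at hp ⊢
  rcases hp with ⟨i, j, ⟨⟨hi, hj⟩, hij, hXi, hXj⟩, rfl⟩ | ⟨i, j, ⟨⟨hi, hj⟩, hij, hXi, hXj⟩, rfl⟩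
  · refine ⟨if i ≤ t then i else i + 1, if j ≤ t then j else j + 1, ⟨⟨?_, ?_⟩, ?_, ?_, ?_⟩, ?_⟩
    all_goals grind [slotMap, slotMapTwo, splitWord, Function.update]
  · refine ⟨if i < t then i else i + 1, if j < t then j else j + 1, ⟨⟨?_, ?_⟩, ?_, ?_, ?_⟩, ?_⟩
    all_goals grind [slotMap, slotMapTwo, splitWord, Function.update]

theorem slotPairsTwo_subset_union {k t N s s' : ℕ} {X : ℕ → Bool} {a b : Bool} (ht : t < k)
    (hab : ¬ (a = true ∧ b = false)) :
    slotPairsTwo k t N X a b s s' ⊆ slotPairs k t N X a s ∪ slotPairs k t N X b s' := by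
  intro p hp
  simp only [slotPairs, slotPairsTwo, wordPairs, mem_union, mem_image, mem_filter, mem_product,
    mem_range, Prod.exists, Prod.map_apply] at hp ⊢
  obtain ⟨i, j, ⟨⟨hi, hj⟩, hij, hXi, hXj⟩, rfl⟩ := hp
  by_cases h : i ≠ t + 1 ∧ j ≠ t + 1
  · left
    refine ⟨if i ≤ t then i else i - 1, if j ≤ t then j else j - 1, ⟨⟨?_, ?_⟩, ?_, ?_, ?_⟩, ?_⟩
    all_goals grind [slotMap, slotMapTwo, splitWord, Function.update]
  · right
    refine ⟨if i < t then i else i - 1, if j < t then j else j - 1, ⟨⟨?_, ?_⟩, ?_, ?_, ?_⟩, ?_⟩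
    all_goals grind [slotMap, slotMapTwo, splitWord, Function.update]

namespace IsSpreadableMoment

variable {P : Finset (ℕ × ℕ) → ℝ}

theorem le_one (h : IsSpreadableMoment P) (S : Finset (ℕ × ℕ)) : P S ≤ 1 :=
  h.empty ▸ h.anti _ _ (empty_subset S)

theorem nonneg (h : IsSpreadableMoment P) (S : Finset (ℕ × ℕ)) : 0 ≤ P S := by
  simpa using h.psd ∅ 0 (fun _ => ∅) 1 S

theorem slotPairs_eq (h : IsSpreadableMoment P) {k t N s : ℕ} (X : ℕ → Bool) (a : Bool)
    (hs : s ≤ N) : P (slotPairs k t N X a s) = P (wordPairs k (Function.update X t a)) :=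
  h.comp _ _ (strictMono_slotMap hs)

theorem union_eq (h : IsSpreadableMoment P) {k t N s s' : ℕ} (X : ℕ → Bool) {a b : Bool}
    (ht : t < k) (hab : ¬ (a = true ∧ b = false)) (hs : s < s') (hs' : s' ≤ N) :
    P (slotPairs k t N X a s ∪ slotPairs k t N X b s') =
      P (wordPairs (k + 1) (splitWord t a b X)) := by
  rw [(slotPairs_union_subset ht).antisymm (slotPairsTwo_subset_union ht hab)]
  exact h.comp _ _ (strictMono_slotMapTwo hs hs')

theorem le_union (h : IsSpreadableMoment P) {k t N s s' : ℕ} (X : ℕ → Bool) (a b : Bool)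
    (ht : t < k) (hs : s < s') (hs' : s' ≤ N) :
    P (wordPairs (k + 1) (splitWord t a b X)) ≤
      P (slotPairs k t N X a s ∪ slotPairs k t N X b s') := by
  rw [← h.comp _ (wordPairs (k + 1) (splitWord t a b X)) (strictMono_slotMapTwo hs hs')]
  exact h.anti _ _ (slotPairs_union_subset ht)

theorem double_letter_pos (h : IsSpreadableMoment P) {k t : ℕ} (X : ℕ → Bool) (a : Bool)
    (ht : t < k) (hpos : 0 < P (wordPairs k (Function.update X t a))) :
    0 < P (wordPairs (k + 1) (splitWord t a a X)) := by
  set q := P (wordPairs k (Function.update X t a)) with hq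
  set q' := P (wordPairs (k + 1) (splitWord t a a X)) with hq'
  obtain ⟨N, hN⟩ := exists_nat_gt (1 / q ^ 2)
  have hN0 : (0 : ℝ) < N := lt_trans (by positivity) hN
  have hpsd := h.psd (range N) (fun _ => 1) (slotPairs k t N X a) (-(N * q)) ∅
  have key : ∀ i ∈ range N, ∀ j ∈ range N,
      P (slotPairs k t N X a i ∪ slotPairs k t N X a j) ≤ q' + if i = j then 1 - q' else 0 := by
    intro i hi j hj
    simp only [mem_range] at hi hj
    have hab : ¬ (a = true ∧ a = false) := by simp
    rcases lt_trichotomy i j with hij | hij | hij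
    · rw [h.union_eq X ht hab hij hj.le, if_neg hij.ne]; simp [hq']
    · rw [if_pos hij]; simpa using h.le_one _
    · rw [union_comm, h.union_eq X ht hab hij hi.le, if_neg hij.ne']; simp [hq']
  have key1 : ∀ i ∈ range N, P (slotPairs k t N X a i) = q := by
    intro i hi
    exact h.slotPairs_eq X a (mem_range.1 hi).le
  have e1 : ∑ i ∈ range N, P (slotPairs k t N X a i) = N * q := by
    rw [sum_congr rfl key1]; simp
  have e2 : ∑ i ∈ range N, ∑ j ∈ range N, P (slotPairs k t N X a i ∪ slotPairs k t N X a j) ≤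
      ∑ i ∈ range N, ∑ j ∈ range N, (q' + if i = j then 1 - q' else 0) :=
    sum_le_sum fun i hi => sum_le_sum fun j hj => key i hi j hj
  have e3 : ∑ i ∈ range N, ∑ j ∈ range N, (q' + if i = j then 1 - q' else 0) =
      N ^ 2 * q' + N * (1 - q') := by
    simp only [sum_add_distrib, sum_const, card_range, sum_ite_eq, nsmul_eq_mul]
    rw [sum_congr rfl (g := fun _ => 1 - q')]
    · simp; ring
    · intro i hi; rw [if_pos hi]
  simp only [one_mul, union_empty, e1, h.empty] at hpsd
  by_contra hneg
  push Not at hneg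
  have h1 : 1 < N * q ^ 2 := by
    rw [div_lt_iff₀ (by positivity)] at hN; linarith
  have hN1 : (1 : ℝ) ≤ N := by exact_mod_cast Nat.one_le_iff_ne_zero.2 (by rintro rfl; simp at hN0)
  have h2 : N ^ 2 * q ^ 2 ≤ N ^ 2 * q' + N * (1 - q') := by linarith
  have h3 : N * 1 < N * (N * q ^ 2) := by gcongr
  nlinarith [mul_nonneg hN0.le (sub_nonneg.2 hN1)]

theorem swap_letters_le (h : IsSpreadableMoment P) {k t : ℕ} (X : ℕ → Bool) (ht : t < k) :
    P (wordPairs (k + 1) (splitWord t true false X)) ≤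
      P (wordPairs (k + 1) (splitWord t false true X)) := by
  set d := P (wordPairs (k + 1) (splitWord t true false X)) with hd
  set c := P (wordPairs (k + 1) (splitWord t false true X)) with hc
  set q := P (wordPairs (k + 1) (splitWord t true true X)) with hq
  by_contra! hlt
  obtain ⟨M, hM⟩ := exists_nat_gt (2 / (d - c))
  have hdc : 0 < d - c := by linarith
  have hM0 : (0 : ℝ) < M := lt_trans (by positivity) hM
  set N := M ^ 2 with hN
  let pos : ℕ → ℕ := fun s => if s < N then s else s + 1
  let sgn : ℕ → ℝ := fun s => if s < N then -1 else 1
  let A : ℕ → Finset (ℕ × ℕ) := fun s => slotPairs k t (2 * N) X true (pos s)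
  let B : Finset (ℕ × ℕ) := slotPairs k t (2 * N) X false N
  have hpsd := h.psd (range (2 * N)) sgn A M B
  have hposlt : ∀ i j, i < j → pos i < pos j := by
    intro i j hij
    simp only [pos]
    split_ifs <;> omega
  have hposle : ∀ i, i < 2 * N → pos i ≤ 2 * N := by
    intro i hi
    simp only [pos]
    split_ifs <;> omega
  have hsgn : ∑ i ∈ range (2 * N), sgn i = 0 := by
    rw [two_mul, sum_range_add]
    have h1 : ∀ i ∈ range N, sgn i = -1 := fun i hi => by simp [sgn, mem_range.1 hi]
    have h2 : ∀ i ∈ range N, sgn (N + i) = 1 := fun i hi => by simp [sgn]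
    rw [sum_congr rfl h1, sum_congr rfl h2]
    simp
  have hAA : ∀ i ∈ range (2 * N), ∀ j ∈ range (2 * N), sgn i * sgn j * P (A i ∪ A j) ≤
      q * (sgn i * sgn j) + if i = j then 1 else 0 := by
    intro i hi j hj
    simp only [mem_range] at hi hj
    have hab : ¬ (true = true ∧ true = false) := by simp
    rcases lt_trichotomy i j with hij | hij | hij
    · simp only [A]
      rw [h.union_eq X ht hab (hposlt i j hij) (hposle j hj), if_neg hij.ne, ← hq]
      linarith
    · subst hij
      have h1 : sgn i * sgn i = 1 := by simp only [sgn]; split_ifs <;> norm_num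
      rw [h1, if_pos rfl]
      have := h.le_one (A i ∪ A i)
      have := h.nonneg (wordPairs (k + 1) (splitWord t true true X))
      linarith
    · simp only [A]
      rw [union_comm, h.union_eq X ht hab (hposlt j i hij) (hposle i hi), if_neg hij.ne', ← hq]
      linarith
  have hAAsum : ∑ i ∈ range (2 * N), ∑ j ∈ range (2 * N), sgn i * sgn j * P (A i ∪ A j) ≤
      2 * N := by
    refine (sum_le_sum fun i hi => sum_le_sum fun j hj => hAA i hi j hj).trans ?_
    simp only [sum_add_distrib, ← mul_sum, hsgn, mul_zero, zero_add, sum_ite_eq]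
    rw [sum_congr rfl (g := fun _ => (1 : ℝ)) fun i hi => if_pos hi]
    simp
  have hAB : ∑ i ∈ range (2 * N), sgn i * P (A i ∪ B) ≤ N * (c - d) := by
    rw [two_mul, sum_range_add]
    have h1 : ∀ i ∈ range N, sgn i * P (A i ∪ B) ≤ -d := by
      intro i hi
      have hi' := mem_range.1 hi
      have := h.le_union (N := 2 * N) X true false ht hi' (by omega)
      simp only [sgn, A, B, pos, hi', if_true]
      linarith
    have h2 : ∀ i ∈ range N, sgn (N + i) * P (A (N + i) ∪ B) ≤ c := by
      intro i hi
      have hi' := mem_range.1 hi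
      have := h.union_eq (N := 2 * N) (s := N) (s' := N + i + 1) X (a := false) (b := true) ht
        (by simp) (by omega) (by omega)
      rw [union_comm]
      simp only [sgn, A, B, pos, show ¬ N + i < N by omega, if_false, one_mul]
      exact this.le
    have := add_le_add (sum_le_sum h1) (sum_le_sum h2)
    simp only [sum_const, card_range, nsmul_eq_mul] at this
    linarith
  have hB := h.le_one B
  have hM2 : 2 < M * (d - c) := by rwa [div_lt_iff₀ hdc] at hM
  have hNM : (N : ℝ) = M ^ 2 := by rw [hN]; push_cast; rfl
  rw [hNM] at hAAsum hAB
  have h1 : 2 * (M : ℝ) * ∑ i ∈ range (2 * N), sgn i * P (A i ∪ B) ≤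
      2 * M * (M ^ 2 * (c - d)) := by gcongr
  have h2 : (M : ℝ) ^ 2 * P B ≤ M ^ 2 * 1 := by gcongr
  have h3 : (M : ℝ) ^ 2 * 2 < M ^ 2 * (M * (d - c)) := by gcongr
  nlinarith [sq_nonneg (M : ℝ)]

/-- The pairs directed from a source letter to a sink letter of a word. -/
def listPairs (w : List Bool) : Finset (ℕ × ℕ) :=
  wordPairs w.length fun i => w.getD i false

theorem wordPairs_congr {k : ℕ} {X Y : ℕ → Bool} (h : ∀ i < k, X i = Y i) :
    wordPairs k X = wordPairs k Y := by
  refine filter_congr fun p hp => ?_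
  simp only [mem_product, mem_range] at hp
  rw [h _ hp.1, h _ hp.2]

theorem listPairs_split (w₁ w₂ : List Bool) (a b : Bool) :
    listPairs (w₁ ++ a :: b :: w₂) = wordPairs ((w₁.length + w₂.length + 1) + 1)
      (splitWord w₁.length a b fun i => (w₁ ++ false :: w₂).getD i false) := by
  have hl : (w₁ ++ a :: b :: w₂).length = (w₁.length + w₂.length + 1) + 1 := by simp; omega
  rw [listPairs, hl]
  refine wordPairs_congr fun i _ => ?_
  simp only [splitWord]
  split_ifs with h1 h2 h3
  · rw [List.getD_append _ _ _ _ h1, List.getD_append _ _ _ _ h1]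
  · subst h2
    simp
  · subst h3
    simp
  · obtain ⟨j, rfl⟩ : ∃ j, i = w₁.length + (j + 2) :=
      ⟨i - w₁.length - 2, by omega⟩
    rw [List.getD_append_right _ _ _ _ (by omega), List.getD_append_right _ _ _ _ (by omega)]
    simp

theorem listPairs_update (w₁ w₂ : List Bool) (a : Bool) :
    listPairs (w₁ ++ a :: w₂) = wordPairs (w₁.length + w₂.length + 1)
      (Function.update (fun i => (w₁ ++ false :: w₂).getD i false) w₁.length a) := by
  have hl : (w₁ ++ a :: w₂).length = w₁.length + w₂.length + 1 := by simp; omega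
  rw [listPairs, hl]
  refine wordPairs_congr fun i _ => ?_
  rcases lt_trichotomy i w₁.length with h1 | h1 | h1
  · rw [Function.update_of_ne h1.ne, List.getD_append _ _ _ _ h1, List.getD_append _ _ _ _ h1]
  · subst h1
    simp
  · obtain ⟨j, rfl⟩ : ∃ j, i = w₁.length + (j + 1) := ⟨i - w₁.length - 1, by omega⟩
    rw [Function.update_of_ne h1.ne', List.getD_append_right _ _ _ _ (by omega),
      List.getD_append_right _ _ _ _ (by omega)]
    simp

theorem listPairs_double_pos (h : IsSpreadableMoment P) {w₁ w₂ : List Bool} {a : Bool}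
    (hpos : 0 < P (listPairs (w₁ ++ a :: w₂))) : 0 < P (listPairs (w₁ ++ a :: a :: w₂)) := by
  rw [listPairs_split]
  rw [listPairs_update] at hpos
  exact h.double_letter_pos _ _ (by omega) hpos

theorem listPairs_swap_pos (h : IsSpreadableMoment P) {w₁ w₂ : List Bool}
    (hpos : 0 < P (listPairs (w₁ ++ true :: false :: w₂))) :
    0 < P (listPairs (w₁ ++ false :: true :: w₂)) := by
  rw [listPairs_split] at hpos ⊢
  exact hpos.trans_le (h.swap_letters_le _ (by omega))

theorem listPairs_sorted_pos (h : IsSpreadableMoment P) (h01 : 0 < P {(0, 1)}) (l r : ℕ) :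
    0 < P (listPairs (List.replicate (l + 1) true ++ List.replicate (r + 1) false)) := by
  have hx : 0 < P (listPairs (List.replicate (l + 1) true ++ [false])) := by
    induction l with
    | zero =>
      have : listPairs (List.replicate (0 + 1) true ++ [false]) = {(0, 1)} := by decide
      rwa [this]
    | succ l ih =>
      have := h.listPairs_double_pos (w₁ := []) (a := true)
        (w₂ := List.replicate l true ++ [false]) (by simpa [List.replicate_succ] using ih)
      simpa [List.replicate_succ] using this
  induction r with
  | zero => exact hx
  | succ r ih =>
    have := h.listPairs_double_pos (w₁ := List.replicate (l + 1) true) (a := false)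
      (w₂ := List.replicate r false) (by simpa [List.replicate_succ] using ih)
    simpa [List.replicate_succ] using this

theorem listPairs_move_pos (h : IsSpreadableMoment P) (l : ℕ) : ∀ (w₁ w₂ : List Bool),
    0 < P (listPairs (w₁ ++ (List.replicate l true ++ false :: w₂))) →
    0 < P (listPairs (w₁ ++ false :: (List.replicate l true ++ w₂))) := by
  induction l with
  | zero => intro w₁ w₂ hpos; simpa using hpos
  | succ l ih =>
    intro w₁ w₂ hpos
    have h1 := ih (w₁ ++ [true]) w₂ (by simpa [List.replicate_succ] using hpos)
    have h2 := h.listPairs_swap_pos (w₁ := w₁) (w₂ := List.replicate l true ++ w₂)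
      (by simpa using h1)
    simpa [List.replicate_succ] using h2

theorem listPairs_append_pos (h : IsSpreadableMoment P) (w : List Bool) : ∀ u : List Bool,
    0 < P (listPairs (u ++ (List.replicate (w.count true) true ++
      List.replicate (w.count false) false))) →
    0 < P (listPairs (u ++ w)) := by
  induction w with
  | nil => intro u hpos; simpa using hpos
  | cons a w ih =>
    intro u hpos
    cases a with
    | true =>
      have := ih (u ++ [true]) (by simpa [List.replicate_succ] using hpos)
      simpa using this
    | false =>
      have h1 := h.listPairs_move_pos (w.count true) u (List.replicate (w.count false) false)
        (by simpa [List.replicate_succ] using hpos)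
      have := ih (u ++ [false]) (by simpa using h1)
      simpa using this

theorem wordPairs_pos (h : IsSpreadableMoment P) (h01 : 0 < P {(0, 1)}) (k : ℕ)
    (X : ℕ → Bool) : 0 < P (wordPairs k X) := by
  set w : List Bool := List.ofFn (n := k) (fun i => X i) with hw
  have hlen : (w ++ [true, false]).length = k + 2 := by simp [hw]
  have h1 : 0 < P (listPairs (w ++ [true, false])) := by
    have := h.listPairs_append_pos (w ++ [true, false]) []
    refine this ?_
    simpa using h.listPairs_sorted_pos h01 (w.count true) (w.count false)
  refine h1.trans_le (h.anti _ _ ?_)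
  intro p hp
  simp only [listPairs, wordPairs, mem_filter, mem_product, mem_range, hlen] at hp ⊢
  obtain ⟨⟨hp1, hp2⟩, hlt, hX1, hX2⟩ := hp
  have hget : ∀ i < k, (w ++ [true, false]).getD i false = X i := by
    intro i hi
    rw [List.getD_append _ _ _ _ (by simpa [hw] using hi)]
    simp [hw, List.getD_eq_getElem?_getD, hi]
  rw [hget _ hp1, hget _ hp2]
  exact ⟨⟨by omega, by omega⟩, hlt, hX1, hX2⟩

end IsSpreadableMoment

/-! ### Limit densities of a sequence of systems of events -/

section LimitDensity

open Filter Topology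

open scoped Classical in
/-- The proportion of points of `W` lying in all events `E (σ i) (σ j)`, `(i, j) ∈ S`. -/
noncomputable def eventDensity {W : Type} [Fintype W] (E : ℕ → ℕ → W → Prop) (σ : ℕ → ℕ)
    (S : Finset (ℕ × ℕ)) : ℝ :=
  ((univ.filter fun v => ∀ p ∈ S, E (σ p.1) (σ p.2) v).card : ℝ) / Fintype.card W

section

variable {W : Type} [Fintype W] (E : ℕ → ℕ → W → Prop) (σ : ℕ → ℕ)

theorem eventDensity_nonneg (S : Finset (ℕ × ℕ)) : 0 ≤ eventDensity E σ S := by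
  unfold eventDensity; positivity

theorem eventDensity_anti {S T : Finset (ℕ × ℕ)} (h : S ⊆ T) :
    eventDensity E σ T ≤ eventDensity E σ S := by
  unfold eventDensity
  refine div_le_div_of_nonneg_right ?_ (by positivity)
  rw [Nat.cast_le]
  refine card_le_card fun v hv => ?_
  simp only [mem_filter] at hv ⊢
  exact ⟨hv.1, fun p hp => hv.2 p (h hp)⟩

theorem eventDensity_le_one (S : Finset (ℕ × ℕ)) : eventDensity E σ S ≤ 1 := by
  unfold eventDensity
  refine div_le_one_of_le₀ ?_ (by positivity)
  exact_mod_cast card_le_univ _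

theorem eventDensity_empty [Nonempty W] : eventDensity E σ ∅ = 1 := by
  simp [eventDensity]

theorem eventDensity_image (θ : ℕ → ℕ) (S : Finset (ℕ × ℕ)) :
    eventDensity E σ (S.image (Prod.map θ θ)) = eventDensity E (σ ∘ θ) S := by
  unfold eventDensity
  congr 3
  ext v
  simp only [mem_filter, forall_mem_image, Prod.map_fst, Prod.map_snd, Function.comp_apply]

open scoped Classical in
theorem eventDensity_eq_sum (S : Finset (ℕ × ℕ)) : eventDensity E σ S =
    (∑ v : W, if ∀ p ∈ S, E (σ p.1) (σ p.2) v then (1 : ℝ) else 0) / Fintype.card W := by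
  simp [eventDensity]

theorem eventDensity_psd (s : Finset ℕ) (c : ℕ → ℝ) (S : ℕ → Finset (ℕ × ℕ)) (r : ℝ)
    (T : Finset (ℕ × ℕ)) :
    0 ≤ ∑ i ∈ s, ∑ j ∈ s, c i * c j * eventDensity E σ (S i ∪ S j) +
      2 * r * ∑ i ∈ s, c i * eventDensity E σ (S i ∪ T) + r ^ 2 * eventDensity E σ T := by
  classical
  let f : Finset (ℕ × ℕ) → W → ℝ := fun S v => if ∀ p ∈ S, E (σ p.1) (σ p.2) v then 1 else 0
  have hf : ∀ S T v, f (S ∪ T) v = f S v * f T v := by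
    intro S T v
    simp only [f, mem_union, or_imp, forall_and, ite_and, ite_mul, one_mul, zero_mul]
  have hd : ∀ S, eventDensity E σ S = (∑ v, f S v) / Fintype.card W :=
    fun S => eventDensity_eq_sum E σ S
  have hff : ∀ S v, f S v = f S v * f S v := fun S v => by rw [← hf, union_self]
  have key : ∑ i ∈ s, ∑ j ∈ s, c i * c j * eventDensity E σ (S i ∪ S j) +
      2 * r * ∑ i ∈ s, c i * eventDensity E σ (S i ∪ T) + r ^ 2 * eventDensity E σ T =
      (∑ v, (∑ i ∈ s, c i * f (S i) v + r * f T v) ^ 2) / Fintype.card W := by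
    have h1 : ∀ v, (∑ i ∈ s, c i * f (S i) v + r * f T v) ^ 2 =
        ∑ i ∈ s, ∑ j ∈ s, c i * c j * f (S i ∪ S j) v +
          2 * r * ∑ i ∈ s, c i * f (S i ∪ T) v + r ^ 2 * f T v := by
      intro v
      rw [add_sq, sq (∑ i ∈ s, c i * f (S i) v), sum_mul_sum, mul_pow, sq (f T v), ← hff]
      simp only [hf, mul_sum, sum_mul]
      congr 1
      · congr 1
        · refine sum_congr rfl fun i _ => sum_congr rfl fun j _ => by ring
        · refine sum_congr rfl fun i _ => by ring
    simp only [h1, sum_add_distrib, ← mul_sum, hd, add_div]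
    congr 1
    · congr 1
      · rw [sum_comm (s := univ), sum_div]
        refine sum_congr rfl fun i _ => ?_
        rw [sum_comm (s := univ), sum_div]
        refine sum_congr rfl fun j _ => ?_
        rw [← mul_sum, mul_div_assoc]
      · rw [sum_comm (s := univ), mul_div_assoc, sum_div]
        congr 1
        refine sum_congr rfl fun j _ => ?_
        rw [← mul_sum, mul_div_assoc]
    · rw [mul_div_assoc]
  rw [key]
  positivity

end

theorem Ultrafilter.exists_tendsto_of_mem_Icc {ι : Type*} (G : Ultrafilter ι) {f : ι → ℝ}
    {a b : ℝ} (hf : ∀ z, f z ∈ Set.Icc a b) : ∃ x, Tendsto f G (𝓝 x) := by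
  obtain ⟨x, -, hx⟩ := (isCompact_Icc (a := a) (b := b)).ultrafilter_le_nhds (G.map f)
    (le_principal_iff.2 (Ultrafilter.mem_map.2 (univ_mem' hf)))
  exact ⟨x, hx⟩

/-- The ultrafilter choosing a sequence of labels first, then the index of a system. -/
noncomputable def systemUltra : Ultrafilter (ℕ × (ℕ → ℕ)) :=
  seqUltra.bind fun σ => (hyperfilter ℕ).map fun m => (m, σ)

theorem eventually_systemUltra (R : ℕ × (ℕ → ℕ) → Prop) :
    (∀ᶠ z in (systemUltra : Filter (ℕ × (ℕ → ℕ))), R z) ↔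
      ∀ᶠ σ in (seqUltra : Filter (ℕ → ℕ)), ∀ᶠ m in (hyperfilter ℕ : Filter ℕ), R (m, σ) :=
  Iff.rfl

theorem exists_limit_moment (W : ℕ → Type) [∀ m, Fintype (W m)] [∀ m, Nonempty (W m)]
    (E : ∀ m, ℕ → ℕ → W m → Prop) :
    ∃ P : Finset (ℕ × ℕ) → ℝ, IsSpreadableMoment P ∧
      ∀ S, Tendsto (fun z : ℕ × (ℕ → ℕ) => eventDensity (E z.1) z.2 S) systemUltra (𝓝 (P S)) := by
  have hex : ∀ S, ∃ x : ℝ,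
      Tendsto (fun z : ℕ × (ℕ → ℕ) => eventDensity (E z.1) z.2 S) systemUltra (𝓝 x) := by
    intro S
    exact systemUltra.exists_tendsto_of_mem_Icc fun z =>
      ⟨eventDensity_nonneg _ _ _, eventDensity_le_one _ _ _⟩
  choose P hP using hex
  refine ⟨P, ⟨?_, ?_, ?_, ?_⟩, hP⟩
  · refine tendsto_nhds_unique (hP ∅) ?_
    simp only [eventDensity_empty]
    exact tendsto_const_nhds
  · intro S T hST
    exact le_of_tendsto_of_tendsto' (hP T) (hP S) fun z => eventDensity_anti _ _ hST
  · intro s c S r T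
    refine ge_of_tendsto' (((tendsto_finsetSum s fun i _ => tendsto_finsetSum s fun j _ =>
      (hP (S i ∪ S j)).const_mul (c i * c j)).add
      ((tendsto_finsetSum s fun i _ => (hP (S i ∪ T)).const_mul (c i)).const_mul (2 * r))).add
      ((hP T).const_mul (r ^ 2))) fun z => ?_
    exact eventDensity_psd _ _ s c S r T
  · intro θ S hθ
    refine tendsto_nhds_unique (hP _) ?_
    simp only [eventDensity_image]
    rw [tendsto_def]
    intro N hN
    obtain ⟨k, hk⟩ : ∃ k, ∀ p ∈ S, p.1 < k ∧ p.2 < k := by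
      refine ⟨S.sup (fun p => p.1 + p.2) + 1, fun p hp => ?_⟩
      have : p.1 + p.2 ≤ S.sup (fun p => p.1 + p.2) := le_sup (f := fun p => p.1 + p.2) hp
      omega
    have hdep : DependsOnFirst k fun σ => ∀ᶠ m in (hyperfilter ℕ : Filter ℕ),
        eventDensity (E m) σ S ∈ N := by
      intro σ τ hστ
      have : ∀ m, eventDensity (E m) σ S = eventDensity (E m) τ S := by
        intro m
        unfold eventDensity
        congr 3
        ext v
        simp only [mem_filter]
        refine and_congr_right fun _ => forall₂_congr fun p hp => ?_
        rw [hστ _ (hk p hp).1, hστ _ (hk p hp).2]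
      simp only [this]
    have h1 := hP S hN
    exact (eventually_seqUltra_comp hθ hdep).2 ((eventually_seqUltra hdep).1 h1)

end LimitDensity

/-! ### Finding all orientated bipartite patterns simultaneously -/

open scoped Classical in
theorem exists_rich_tuple (k M : ℕ) (ε : ℝ) (hε : 0 < ε) :
    ∃ m : ℕ, ∀ (U W : Type) [Fintype U] [Fintype W] (E : U → U → W → Prop),
      m ≤ Fintype.card U → m ≤ Fintype.card W →
      (∀ u₁ u₂, u₁ ≠ u₂ →
        ε * Fintype.card W ≤ ((univ.filter fun v => E u₁ u₂ v).card : ℝ)) →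
      ∃ u : ℕ → U, (∀ i < k, ∀ j < k, u i = u j → i = j) ∧
        ∀ X : ℕ → Bool, M ≤ (univ.filter fun v => ∀ i < k, ∀ j < k, i < j →
          X i = true → X j = false → E (u i) (u j) v).card := by
  by_contra! hcon
  choose U W instU instW E hU hW hE hbad using fun m => hcon (m + 1)
  have hlab : ∀ m, ∃ g : ℕ → U m, ∀ i < m, ∀ j < m, g i = g j → i = j := by
    intro m
    obtain ⟨f⟩ : Nonempty (Fin (m + 1) ↪ U m) :=
      Function.Embedding.nonempty_of_card_le (by simpa using hU m)
    refine ⟨fun i => if h : i < m + 1 then f ⟨i, h⟩ else f 0, fun i hi j hj hij => ?_⟩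
    simp only [dif_pos (show i < m + 1 by omega), dif_pos (show j < m + 1 by omega)] at hij
    simpa using f.injective hij
  choose g hg using hlab
  have : ∀ m, Nonempty (W m) := fun m => by
    rw [← Fintype.card_pos_iff]
    have := hW m
    omega
  let E' : ∀ m, ℕ → ℕ → W m → Prop := fun m i j v => E m (g m i) (g m j) v
  obtain ⟨P, hP, hlim⟩ := exists_limit_moment W E'
  have hlarge : ∀ n : ℕ, ∀ᶠ z in (systemUltra : Filter (ℕ × (ℕ → ℕ))), n < z.1 := by
    intro n
    rw [eventually_systemUltra]
    exact Filter.Eventually.of_forall fun σ =>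
      Nat.hyperfilter_le_atTop (Filter.eventually_gt_atTop n)
  have hlt : ∀ a : ℕ, ∀ᶠ z in (systemUltra : Filter (ℕ × (ℕ → ℕ))), z.2 a < z.1 := by
    intro a
    rw [eventually_systemUltra]
    exact Filter.Eventually.of_forall fun σ =>
      Nat.hyperfilter_le_atTop (Filter.eventually_gt_atTop (σ a))
  have hne : ∀ a b : ℕ, a < b →
      ∀ᶠ z in (systemUltra : Filter (ℕ × (ℕ → ℕ))), z.2 a ≠ z.2 b := by
    intro a b hab
    rw [eventually_systemUltra]
    exact (eventually_seqUltra_ne hab).mono fun σ h => Filter.Eventually.of_forall fun _ => h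
  have h01 : 0 < P {(0, 1)} := by
    refine hε.trans_le (ge_of_tendsto (hlim {(0, 1)}) ?_)
    filter_upwards [hlt 0, hlt 1, hne 0 1 (by norm_num)] with z h0 h1 h2
    have hW0 : (0 : ℝ) < Fintype.card (W z.1) := by exact_mod_cast Fintype.card_pos
    rw [eventDensity, le_div_iff₀ hW0]
    have := hE z.1 (g z.1 (z.2 0)) (g z.1 (z.2 1)) fun h => h2 (hg z.1 _ h0 _ h1 h)
    simpa [E'] using this
  have hword : ∀ X : ℕ → Bool, ∀ᶠ z in (systemUltra : Filter (ℕ × (ℕ → ℕ))),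
      (M : ℝ) ≤ eventDensity (E' z.1) z.2 (wordPairs k X) * Fintype.card (W z.1) := by
    intro X
    have hpos := hP.wordPairs_pos h01 k X
    set q := P (wordPairs k X) with hq
    obtain ⟨n, hn⟩ := exists_nat_gt (M / (q / 2))
    filter_upwards [(hlim (wordPairs k X)).eventually (lt_mem_nhds (half_lt_self hpos)),
      hlarge n] with z h1 h2
    rw [div_lt_iff₀ (by positivity)] at hn
    have h3 : (n : ℝ) ≤ Fintype.card (W z.1) := by
      have := hW z.1
      exact_mod_cast (show n ≤ Fintype.card (W z.1) by omega)
    calc (M : ℝ) ≤ q / 2 * n := by linarith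
      _ ≤ _ := mul_le_mul h1.le h3 (by positivity) (eventDensity_nonneg _ _ _)
  have hwords : ∀ᶠ z in (systemUltra : Filter (ℕ × (ℕ → ℕ))), ∀ A ∈ (range k).powerset,
      (M : ℝ) ≤ eventDensity (E' z.1) z.2 (wordPairs k fun i => decide (i ∈ A)) *
        Fintype.card (W z.1) :=
    (Filter.eventually_all_finset _).2 fun A _ => hword _
  have hlts : ∀ᶠ z in (systemUltra : Filter (ℕ × (ℕ → ℕ))), ∀ a ∈ range k, z.2 a < z.1 :=
    (Filter.eventually_all_finset _).2 fun a _ => hlt a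
  have hnes : ∀ᶠ z in (systemUltra : Filter (ℕ × (ℕ → ℕ))), ∀ p ∈ range k ×ˢ range k,
      p.1 < p.2 → z.2 p.1 ≠ z.2 p.2 := by
    refine (Filter.eventually_all_finset _).2 fun p _ => ?_
    by_cases h : p.1 < p.2
    · exact (hne _ _ h).mono fun z hz _ => hz
    · exact Filter.Eventually.of_forall fun z h' => absurd h' h
  obtain ⟨z, hz1, hz2, hz3⟩ := (hwords.and (hlts.and hnes)).exists
  obtain ⟨X, hX⟩ := hbad z.1 (fun i => g z.1 (z.2 i)) (by
    intro i hi j hj hij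
    have hσ := hg z.1 _ (hz2 i (mem_range.2 hi)) _ (hz2 j (mem_range.2 hj)) hij
    rcases lt_trichotomy i j with h | h | h
    · exact absurd hσ (hz3 (i, j) (by simp [hi, hj]) h)
    · exact h
    · exact absurd hσ.symm (hz3 (j, i) (by simp [hi, hj]) h))
  have hfin := hz1 ((range k).filter fun i => X i = true) (by simp)
  have hW0 : (0 : ℝ) < Fintype.card (W z.1) := by exact_mod_cast Fintype.card_pos
  rw [eventDensity, div_mul_cancel₀ _ hW0.ne', Nat.cast_le] at hfin
  refine absurd (hfin.trans (card_le_card ?_)) (not_le.2 hX)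
  intro v hv
  simp only [mem_filter, mem_univ, true_and, wordPairs, mem_product, mem_range] at hv ⊢
  intro i hi j hj hij hXi hXj
  exact hv (i, j) ⟨⟨hi, hj⟩, hij, by simp [hi, hXi], by simp [hXj]⟩


/-! ### A uniformly dense 3-graph avoiding most 3-graphs -/

section HadamardGraph

/-- A sign matrix with pairwise orthogonal rows. -/
def IsHadamard {X : Type*} [Fintype X] (ψ : X → X → ℝ) : Prop :=
  (∀ x y, ψ x y = 1 ∨ ψ x y = -1) ∧ ∀ x x', x ≠ x' → ∑ y, ψ x y * ψ x' y = 0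

theorem IsHadamard.pi {X ι : Type*} [Fintype X] [Fintype ι] [DecidableEq ι] {ψ : X → X → ℝ}
    (h : IsHadamard ψ) : IsHadamard fun x y : ι → X => ∏ t, ψ (x t) (y t) := by
  refine ⟨fun x y => ?_, fun x x' hx => ?_⟩
  · refine Finset.prod_induction _ (fun z : ℝ => z = 1 ∨ z = -1) ?_ (Or.inl rfl)
      fun t _ => h.1 _ _
    rintro a b (rfl | rfl) (rfl | rfl) <;> simp
  · obtain ⟨t, ht⟩ := Function.ne_iff.1 hx
    have := Finset.prod_univ_sum (fun _ : ι => (univ : Finset X))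
      fun t s => ψ (x t) s * ψ (x' t) s
    rw [Fintype.piFinset_univ] at this
    simp only [← prod_mul_distrib]
    rw [← this]
    exact prod_eq_zero (mem_univ t) (h.2 _ _ ht)

theorem IsHadamard.comp_equiv {X Y : Type*} [Fintype X] [Fintype Y] {ψ : X → X → ℝ}
    (h : IsHadamard ψ) (e : Y ≃ X) : IsHadamard fun x y => ψ (e x) (e y) :=
  ⟨fun _ _ => h.1 _ _, fun x x' hx => by
    rw [e.sum_comp fun y => ψ (e x) y * ψ (e x') y]
    exact h.2 _ _ (e.injective.ne hx)⟩

theorem IsHadamard.sum_sum_sq_le {X : Type*} [Fintype X] {ψ : X → X → ℝ} (h : IsHadamard ψ)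
    (P Q : Finset X) (a b : X → ℝ) (ha : ∀ x, |a x| ≤ 1) (hb : ∀ x, |b x| ≤ 1) :
    (∑ x ∈ P, ∑ y ∈ Q, a x * b y * ψ x y) ^ 2 ≤ (Fintype.card X : ℝ) ^ 3 := by
  classical
  have hcard : ∀ (S : Finset X) (c : X → ℝ), (∀ x, |c x| ≤ 1) →
      ∑ x ∈ S, c x ^ 2 ≤ Fintype.card X := by
    intro S c hc
    calc ∑ x ∈ S, c x ^ 2 ≤ ∑ x ∈ S, (1 : ℝ) :=
          sum_le_sum fun x _ => (sq_le_one_iff_abs_le_one _).2 (hc x)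
      _ ≤ Fintype.card X := by simpa using card_le_univ S
  have hnorm : ∑ y, (∑ x ∈ P, a x * ψ x y) ^ 2 = ∑ x ∈ P, a x ^ 2 * Fintype.card X := by
    simp only [sq (∑ x ∈ P, _), sum_mul_sum]
    rw [sum_comm]
    refine sum_congr rfl fun x hx => ?_
    rw [sum_comm, sum_eq_single_of_mem x hx]
    · have : ∀ y, a x * ψ x y * (a x * ψ x y) = a x ^ 2 := fun y => by
        rcases h.1 x y with h | h <;> rw [h] <;> ring
      simp only [this, sum_const, card_univ, nsmul_eq_mul]
      ring
    · intro x' _ hne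
      have := h.2 x x' hne.symm
      calc ∑ y, a x * ψ x y * (a x' * ψ x' y) = a x * a x' * ∑ y, ψ x y * ψ x' y := by
            rw [mul_sum]; exact sum_congr rfl fun y _ => by ring
        _ = 0 := by rw [this, mul_zero]
  calc (∑ x ∈ P, ∑ y ∈ Q, a x * b y * ψ x y) ^ 2
      = (∑ y ∈ Q, b y * ∑ x ∈ P, a x * ψ x y) ^ 2 := by
        rw [sum_comm]
        simp only [mul_sum]
        congr 1
        exact sum_congr rfl fun y _ => sum_congr rfl fun x _ => by ring
    _ ≤ (∑ y ∈ Q, b y ^ 2) * ∑ y ∈ Q, (∑ x ∈ P, a x * ψ x y) ^ 2 :=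
        sum_mul_sq_le_sq_mul_sq _ _ _
    _ ≤ Fintype.card X * (Fintype.card X * Fintype.card X) := by
        refine mul_le_mul (hcard Q b hb) ?_ (sum_nonneg fun _ _ => sq_nonneg _) (by positivity)
        refine (sum_le_univ_sum_of_nonneg fun _ => sq_nonneg _).trans ?_
        rw [hnorm, ← sum_mul]
        exact mul_le_mul_of_nonneg_right (hcard P a ha) (by positivity)
    _ = (Fintype.card X : ℝ) ^ 3 := by ring

/-- A sign matrix of order four. -/
def signFour : Fin 4 → Fin 4 → ℤ :=
  ![![1, 1, 1, 1], ![1, -1, 1, -1], ![1, 1, -1, -1], ![1, -1, -1, 1]]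

/-- A row permutation of `signFour` for which the entrywise product is again Hadamard. -/
def signFour' : Fin 4 → Fin 4 → ℤ :=
  ![![1, 1, 1, 1], ![1, 1, -1, -1], ![1, -1, -1, 1], ![1, -1, 1, -1]]

theorem isHadamard_of_int {X : Type*} [Fintype X] {ψ : X → X → ℤ}
    (h₁ : ∀ x y, ψ x y = 1 ∨ ψ x y = -1)
    (h₂ : ∀ x x', x ≠ x' → ∑ y, ψ x y * ψ x' y = 0) :
    IsHadamard fun x y => (ψ x y : ℝ) :=
  ⟨fun x y => by
    rcases h₁ x y with h | h <;> simp [h], fun x x' hx => by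
    beta_reduce
    exact_mod_cast h₂ x x' hx⟩

theorem exists_isHadamard_pair (r : ℕ) : ∃ ψ₁ ψ₂ : Fin (4 ^ r) → Fin (4 ^ r) → ℝ,
    IsHadamard ψ₁ ∧ IsHadamard ψ₂ ∧ IsHadamard fun x y => ψ₁ x y * ψ₂ x y := by
  have h₁ : IsHadamard fun x y => (signFour x y : ℝ) :=
    isHadamard_of_int (by decide) (by decide)
  have h₂ : IsHadamard fun x y => (signFour' x y : ℝ) :=
    isHadamard_of_int (by decide) (by decide)
  have h₃ : IsHadamard fun x y => ((signFour x y * signFour' x y : ℤ) : ℝ) :=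
    isHadamard_of_int (by decide) (by decide)
  let e : Fin (4 ^ r) ≃ (Fin r → Fin 4) := (Fintype.equivFinOfCardEq (by simp)).symm
  refine ⟨_, _, (h₁.pi (ι := Fin r)).comp_equiv e, (h₂.pi (ι := Fin r)).comp_equiv e, ?_⟩
  simpa [prod_mul_distrib] using (h₃.pi (ι := Fin r)).comp_equiv e

/-- The indicator function of a pair of signs. -/
noncomputable def signIndicator {X : Type*} (ψ₁ ψ₂ : X → X → ℝ) (s t : ℝ) (x y : X) : ℝ :=
  (1 + s * ψ₁ x y) * (1 + t * ψ₂ x y) / 4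

/-- A kernel is close to the constant `1 / 4` in the cut norm. -/
def IsQuarterRandom {X : Type*} (I : X → X → ℝ) (C : ℝ) : Prop :=
  (∀ x y, |I x y| ≤ 1) ∧ ∀ (P Q : Finset X) (a b : X → ℝ), (∀ x, |a x| ≤ 1) → (∀ x, |b x| ≤ 1) →
    -C ≤ ∑ x ∈ P, ∑ y ∈ Q, a x * b y * (I x y - 1 / 4)

theorem isQuarterRandom_signIndicator {X : Type*} [Fintype X] {ψ₁ ψ₂ : X → X → ℝ}
    (h₁ : IsHadamard ψ₁) (h₂ : IsHadamard ψ₂) (h₃ : IsHadamard fun x y => ψ₁ x y * ψ₂ x y)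
    {s t : ℝ} (hs : s = 1 ∨ s = -1) (ht : t = 1 ∨ t = -1) :
    IsQuarterRandom (signIndicator ψ₁ ψ₂ s t) (√((Fintype.card X : ℝ) ^ 3)) := by
  refine ⟨fun x y => ?_, fun P Q a b ha hb => ?_⟩
  · unfold signIndicator
    rcases hs with rfl | rfl <;> rcases ht with rfl | rfl <;> rcases h₁.1 x y with h | h <;>
      rcases h₂.1 x y with h' | h' <;> rw [h, h'] <;> norm_num
  · have b₁ := abs_le.1 (Real.abs_le_sqrt (h₁.sum_sum_sq_le P Q a b ha hb))
    have b₂ := abs_le.1 (Real.abs_le_sqrt (h₂.sum_sum_sq_le P Q a b ha hb))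
    have b₃ := abs_le.1 (Real.abs_le_sqrt (h₃.sum_sum_sq_le P Q a b ha hb))
    have key : ∑ x ∈ P, ∑ y ∈ Q, a x * b y * (signIndicator ψ₁ ψ₂ s t x y - 1 / 4) =
        (s * ∑ x ∈ P, ∑ y ∈ Q, a x * b y * ψ₁ x y + t * ∑ x ∈ P, ∑ y ∈ Q, a x * b y * ψ₂ x y +
          s * t * ∑ x ∈ P, ∑ y ∈ Q, a x * b y * (ψ₁ x y * ψ₂ x y)) / 4 := by
      simp only [mul_sum, ← sum_add_distrib, sum_div, signIndicator]
      exact sum_congr rfl fun x _ => sum_congr rfl fun y _ => by ring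
    rw [key]
    rcases hs with rfl | rfl <;> rcases ht with rfl | rfl <;> linarith

theorem IsQuarterRandom.le_sum_triangles {X : Type*} [Fintype X] {I J K : X → X → ℝ} {C : ℝ}
    (hI : IsQuarterRandom I C) (hJ : IsQuarterRandom J C) (hK : IsQuarterRandom K C)
    (hC : 0 ≤ C) (P Q R : Finset X) :
    (P.card : ℝ) * Q.card * R.card / 64 - 3 * Fintype.card X * C ≤
      ∑ x ∈ P, ∑ y ∈ Q, ∑ z ∈ R, I x y * J x z * K y z := by
  have hn : ∀ S : Finset X, (S.card : ℝ) ≤ Fintype.card X := fun S => by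
    exact_mod_cast card_le_univ S
  have hsum : ∀ (S : Finset X) (f : X → ℝ), (∀ x, -C ≤ f x) →
      -(Fintype.card X * C) ≤ ∑ x ∈ S, f x := by
    intro S f hf
    calc -(Fintype.card X * C) ≤ -(S.card * C) :=
          neg_le_neg (mul_le_mul_of_nonneg_right (hn S) hC)
      _ = ∑ x ∈ S, -C := by simp
      _ ≤ _ := sum_le_sum fun x _ => hf x
  have one : ∀ x : X, |(fun _ => 1 : X → ℝ) x| ≤ 1 := fun x => by simp
  have t₁ := hsum R (fun _ => ∑ x ∈ P, ∑ y ∈ Q, 1 * 1 * (I x y - 1 / 4))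
    fun _ => hI.2 P Q _ _ one one
  have t₂ := hsum Q (fun y => ∑ x ∈ P, ∑ z ∈ R, I x y * 1 * (J x z - 1 / 4))
    fun y => hJ.2 P R _ _ (fun x => hI.1 x y) one
  have t₃ := hsum P (fun x => ∑ y ∈ Q, ∑ z ∈ R, I x y * J x z * (K y z - 1 / 4))
    fun x => hK.2 Q R _ _ (fun y => hI.1 x y) (fun z => hJ.1 x z)
  have e₁ : ∑ z ∈ R, ∑ x ∈ P, ∑ y ∈ Q, 1 * 1 * (I x y - 1 / 4) =
      ∑ x ∈ P, ∑ y ∈ Q, ∑ z ∈ R, (I x y - 1 / 4) := by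
    rw [sum_comm]
    refine sum_congr rfl fun x _ => ?_
    rw [sum_comm]
    simp only [one_mul]
  have e₂ : ∑ y ∈ Q, ∑ x ∈ P, ∑ z ∈ R, I x y * 1 * (J x z - 1 / 4) =
      ∑ x ∈ P, ∑ y ∈ Q, ∑ z ∈ R, I x y * (J x z - 1 / 4) := by
    rw [sum_comm]
    simp only [mul_one]
  rw [e₁] at t₁
  rw [e₂] at t₂
  have key : ∑ x ∈ P, ∑ y ∈ Q, ∑ z ∈ R, I x y * J x z * K y z =
      ∑ x ∈ P, ∑ y ∈ Q, ∑ z ∈ R, (1 / 64 : ℝ) +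
      1 / 16 * ∑ x ∈ P, ∑ y ∈ Q, ∑ z ∈ R, (I x y - 1 / 4) +
      1 / 4 * ∑ x ∈ P, ∑ y ∈ Q, ∑ z ∈ R, I x y * (J x z - 1 / 4) +
      ∑ x ∈ P, ∑ y ∈ Q, ∑ z ∈ R, I x y * J x z * (K y z - 1 / 4) := by
    simp only [mul_sum, ← sum_add_distrib]
    exact sum_congr rfl fun x _ => sum_congr rfl fun y _ => sum_congr rfl fun z _ => by ring
  have hconst : ∑ x ∈ P, ∑ y ∈ Q, ∑ z ∈ R, (1 / 64 : ℝ) =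
      (P.card : ℝ) * Q.card * R.card / 64 := by
    simp only [sum_const, nsmul_eq_mul]
    ring
  rw [key, hconst]
  have : 0 ≤ Fintype.card X * C := by positivity
  linarith

/-- The signs on the pairs of `x < y < z` follow the pattern `(1, 1)`, `(1, -1)`, `(-1, -1)`. -/
def SignTriangle {X : Type*} (ψ₁ ψ₂ : X → X → ℝ) (x y z : X) : Prop :=
  (ψ₁ x y = 1 ∧ ψ₂ x y = 1) ∧ (ψ₁ x z = 1 ∧ ψ₂ x z = -1) ∧ (ψ₁ y z = -1 ∧ ψ₂ y z = -1)

open scoped Classical in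
/-- The 3-graph whose edges are the increasing triples forming a `SignTriangle`. -/
noncomputable def signGraph {n : ℕ} (ψ₁ ψ₂ : Fin n → Fin n → ℝ) : ThreeGraph (Fin n) where
  edges := univ.filter fun e => ∃ x y z, x < y ∧ y < z ∧ e = {x, y, z} ∧ SignTriangle ψ₁ ψ₂ x y z
  card_eq e he := by
    obtain ⟨x, y, z, hxy, hyz, rfl, -⟩ := (mem_filter.1 he).2
    exact card_eq_three.2 ⟨x, y, z, hxy.ne, (hxy.trans hyz).ne, hyz.ne, rfl⟩

theorem mem_signGraph_edges {n : ℕ} {ψ₁ ψ₂ : Fin n → Fin n → ℝ} {e : Finset (Fin n)} :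
    e ∈ (signGraph ψ₁ ψ₂).edges ↔
      ∃ x y z, x < y ∧ y < z ∧ e = {x, y, z} ∧ SignTriangle ψ₁ ψ₂ x y z := by
  simp [signGraph]

open scoped Classical in
theorem signIndicator_mul_eq_ite {X : Type*} [Fintype X] {ψ₁ ψ₂ : X → X → ℝ}
    (h₁ : IsHadamard ψ₁) (h₂ : IsHadamard ψ₂) (x y z : X) :
    signIndicator ψ₁ ψ₂ 1 1 x y * signIndicator ψ₁ ψ₂ 1 (-1) x z *
      signIndicator ψ₁ ψ₂ (-1) (-1) y z = if SignTriangle ψ₁ ψ₂ x y z then 1 else 0 := by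
  have aux : ∀ (s t : ℝ), (s = 1 ∨ s = -1) → (t = 1 ∨ t = -1) → ∀ x y,
      signIndicator ψ₁ ψ₂ s t x y = if ψ₁ x y = s ∧ ψ₂ x y = t then 1 else 0 := by
    intro s t hs ht x y
    unfold signIndicator
    rcases hs with rfl | rfl <;> rcases ht with rfl | rfl <;> rcases h₁.1 x y with h | h <;>
      rcases h₂.1 x y with h' | h' <;> rw [h, h'] <;> norm_num
  rw [aux 1 1 (by simp) (by simp), aux 1 (-1) (by simp) (by simp),
    aux (-1) (-1) (by simp) (by simp)]
  simp only [SignTriangle, ← ite_and, mul_ite, mul_one, mul_zero]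
  congr 1
  exact propext (by tauto)

theorem increasing_triple_unique {X : Type*} [LinearOrder X] {x y z x' y' z' : X} (hxy : x < y)
    (hyz : y < z) (hxy' : x' < y') (hyz' : y' < z')
    (h : ({x, y, z} : Finset X) = {x', y', z'}) : x = x' ∧ y = y' ∧ z = z' := by
  have hx : x ∈ ({x', y', z'} : Finset X) := h ▸ by simp
  have hy : y ∈ ({x', y', z'} : Finset X) := h ▸ by simp
  have hz : z ∈ ({x', y', z'} : Finset X) := h ▸ by simp
  simp only [mem_insert, mem_singleton] at hx hy hz
  grind

theorem Finset.exists_initial_subset {X : Type*} [LinearOrder X] (U : Finset X) {q : ℕ}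
    (hq : q ≤ U.card) : ∃ P ⊆ U, P.card = q ∧ ∀ x ∈ P, ∀ y ∈ U \ P, x < y := by
  induction q with
  | zero => exact ⟨∅, by simp⟩
  | succ q ih =>
    obtain ⟨P, hPU, hcard, hlt⟩ := ih (by omega)
    have hne : (U \ P).Nonempty := by
      rw [← card_pos, card_sdiff_of_subset hPU]
      omega
    have hmin := min'_mem _ hne
    refine ⟨insert ((U \ P).min' hne) P, insert_subset (mem_sdiff.1 hmin).1 hPU, ?_, ?_⟩
    · rw [card_insert_of_notMem (mem_sdiff.1 hmin).2, hcard]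
    · intro x hx y hy
      simp only [mem_sdiff, mem_insert, not_or] at hy
      have hy' : y ∈ U \ P := mem_sdiff.2 ⟨hy.1, hy.2.2⟩
      rcases mem_insert.1 hx with rfl | hx
      · exact lt_of_le_of_ne (min'_le _ _ hy') (Ne.symm hy.2.1)
      · exact hlt x hx y hy'

theorem le_card_signGraph_edges {n : ℕ} {ψ₁ ψ₂ : Fin n → Fin n → ℝ}
    (h₁ : IsHadamard ψ₁) (h₂ : IsHadamard ψ₂) (h₃ : IsHadamard fun x y => ψ₁ x y * ψ₂ x y)
    (U : Finset (Fin n)) {q : ℕ} (hq : 3 * q ≤ U.card) :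
    (q : ℝ) ^ 3 / 64 - 3 * n * √((n : ℝ) ^ 3) ≤
      (((signGraph ψ₁ ψ₂).edges.filter (fun e => e ⊆ U)).card : ℝ) := by
  classical
  obtain ⟨P, hPU, hPq, hP⟩ := U.exists_initial_subset (q := q) (by omega)
  have hUP : (U \ P).card = U.card - q := by rw [card_sdiff_of_subset hPU, hPq]
  obtain ⟨Q, hQU, hQq, hQ⟩ := (U \ P).exists_initial_subset (q := q) (by omega)
  have hUQ : ((U \ P) \ Q).card = U.card - q - q := by rw [card_sdiff_of_subset hQU, hUP, hQq]
  obtain ⟨R, hRU, hRq, -⟩ := ((U \ P) \ Q).exists_initial_subset (q := q) (by omega)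
  have hcount := IsQuarterRandom.le_sum_triangles
    (isQuarterRandom_signIndicator h₁ h₂ h₃ (s := 1) (t := 1) (by simp) (by simp))
    (isQuarterRandom_signIndicator h₁ h₂ h₃ (s := 1) (t := -1) (by simp) (by simp))
    (isQuarterRandom_signIndicator h₁ h₂ h₃ (s := -1) (t := -1) (by simp) (by simp))
    (Real.sqrt_nonneg _) P Q R
  simp only [signIndicator_mul_eq_ite h₁ h₂, hPq, hQq, hRq, Fintype.card_fin] at hcount
  have hle : (q : ℝ) ^ 3 / 64 = q * q * q / 64 := by ring
  rw [hle]
  refine hcount.trans ?_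
  have hsum : ∑ x ∈ P, ∑ y ∈ Q, ∑ z ∈ R, (if SignTriangle ψ₁ ψ₂ x y z then (1 : ℝ) else 0) =
      ((P ×ˢ Q ×ˢ R).filter fun p => SignTriangle ψ₁ ψ₂ p.1 p.2.1 p.2.2).card := by
    rw [card_filter]
    push_cast
    simp only [sum_product]
  rw [hsum, Nat.cast_le]
  have hlt : ∀ p ∈ (P ×ˢ Q ×ˢ R).filter fun p => SignTriangle ψ₁ ψ₂ p.1 p.2.1 p.2.2,
      p.1 < p.2.1 ∧ p.2.1 < p.2.2 := by
    intro p hp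
    simp only [mem_filter, mem_product] at hp
    exact ⟨hP _ hp.1.1 _ (hQU hp.1.2.1), hQ _ hp.1.2.1 _ (hRU hp.1.2.2)⟩
  refine card_le_card_of_injOn (fun p => {p.1, p.2.1, p.2.2}) ?_ ?_
  · intro p hp
    have hp' := hlt p hp
    simp only [coe_filter, Set.mem_ofPred_eq, mem_product] at hp
    simp only [coe_filter, Set.mem_ofPred_eq, mem_signGraph_edges]
    refine ⟨⟨_, _, _, hp'.1, hp'.2, rfl, hp.2⟩, ?_⟩
    intro x hx
    simp only [mem_insert, mem_singleton] at hx
    rcases hx with rfl | rfl | rfl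
    · exact hPU hp.1.1
    · exact (mem_sdiff.1 (hQU hp.1.2.1)).1
    · exact (mem_sdiff.1 (mem_sdiff.1 (hRU hp.1.2.2)).1).1
  · intro p hp p' hp' h
    obtain ⟨e₁, e₂, e₃⟩ := increasing_triple_unique (hlt p hp).1 (hlt p hp).2 (hlt p' hp').1
      (hlt p' hp').2 h
    exact Prod.ext e₁ (Prod.ext e₂ e₃)

theorem choose_three_le (u : ℕ) : (u.choose 3 : ℝ) / 1728 ≤ ((u / 3 : ℕ) : ℝ) ^ 3 / 64 := by
  rcases lt_or_ge u 3 with hu | hu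
  · rw [Nat.choose_eq_zero_of_lt hu]
    simp only [Nat.cast_zero, zero_div]
    positivity
  · obtain ⟨v, rfl⟩ := Nat.exists_eq_add_of_le' hu
    have hc : ((v + 3).choose 3 : ℝ) * 6 = (v + 3) * (v + 2) * (v + 1) := by
      have := Nat.descFactorial_eq_factorial_mul_choose (v + 3) 3
      simp only [Nat.descFactorial, Nat.factorial] at this
      have h' : (v + 3).choose 3 * 6 = (v + 3) * (v + 2) * (v + 1) := by
        rw [show v + 3 - 0 = v + 3 by omega, show v + 3 - 1 = v + 2 by omega,
          show v + 3 - 2 = v + 1 by omega] at this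
        linarith
      exact_mod_cast h'
    have hq : ((v : ℝ) + 1) / 3 ≤ ((v + 3) / 3 : ℕ) := by
      rw [div_le_iff₀ (by norm_num)]
      exact_mod_cast (show v + 1 ≤ (v + 3) / 3 * 3 by omega)
    have hq3 : (((v : ℝ) + 1) / 3) ^ 3 ≤ (((v + 3) / 3 : ℕ) : ℝ) ^ 3 :=
      pow_le_pow_left₀ (by positivity) hq 3
    have hv : (0 : ℝ) ≤ v := by positivity
    nlinarith [mul_nonneg hv hv, mul_nonneg hv (mul_nonneg hv hv)]

theorem exists_uniformlyDense_signGraph (η : ℝ) (hη : 0 < η) (n₀ : ℕ) :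
    ∃ n, n₀ ≤ n ∧ ∃ ψ₁ ψ₂ : Fin n → Fin n → ℝ,
      UniformlyDense (signGraph ψ₁ ψ₂) (1 / 1728) η := by
  obtain ⟨N, hN⟩ := exists_nat_gt (9 / η ^ 2)
  obtain ⟨ψ₁, ψ₂, h₁, h₂, h₃⟩ := exists_isHadamard_pair (n₀ + N)
  have hpow : n₀ + N < 4 ^ (n₀ + N) := Nat.lt_pow_self (by norm_num)
  refine ⟨4 ^ (n₀ + N), by omega, ψ₁, ψ₂, fun U => ?_⟩
  have hle := le_card_signGraph_edges h₁ h₂ h₃ U (q := U.card / 3) (by omega)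
  have hch := choose_three_le U.card
  generalize hn : 4 ^ (n₀ + N) = n at *
  have hn9 : 9 ≤ η ^ 2 * n := by
    have hNn : (N : ℝ) ≤ n := by exact_mod_cast (show N ≤ n by omega)
    rw [div_lt_iff₀ (by positivity)] at hN
    nlinarith [sq_nonneg η]
  have hsqrt : √((n : ℝ) ^ 3) ≤ η * n ^ 2 / 3 := by
    refine Real.sqrt_le_iff.2 ⟨by positivity, ?_⟩
    have : (0 : ℝ) ≤ (n : ℝ) ^ 3 := by positivity
    nlinarith
  have : 3 * n * √((n : ℝ) ^ 3) ≤ η * n ^ 3 := by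
    calc 3 * n * √((n : ℝ) ^ 3) ≤ 3 * n * (η * n ^ 2 / 3) := by gcongr
      _ = η * n ^ 3 := by ring
  linarith

end HadamardGraph

theorem exists_order_of_piUnif_eq_zero {α : Type*} [DecidableEq α] (F : ThreeGraph α)
    (hF : piUnif F = 0) : ∃ (φ : α → ℕ) (S : α → α → Prop), Function.Injective φ ∧
      ∀ a a' b, a ≠ b → a' ≠ b → ({a, a', b} : Finset α) ∈ F.edges → φ a < φ a' →
        S b a ∧ ¬ S b a' := by
  have hnot : ¬ ∀ η : ℝ, 0 < η → ∀ n₀ : ℕ, ∃ n : ℕ, n₀ ≤ n ∧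
      ∃ H : ThreeGraph (Fin n), ¬ HasCopy H F ∧ UniformlyDense H (1 / 1728) η := by
    intro h
    have : (1 / 1728 : ℝ) ≤ piUnif F :=
      le_csSup ⟨1, fun d hd => hd.2.1⟩ ⟨by norm_num, by norm_num, h⟩
    rw [hF] at this
    norm_num at this
  push Not at hnot
  obtain ⟨η, hη, n₀, hcopy⟩ := hnot
  obtain ⟨n, hn, ψ₁, ψ₂, hdense⟩ := exists_uniformlyDense_signGraph η hη n₀
  obtain ⟨φ, hφ, hedge⟩ := by_contra fun h => hcopy n hn (signGraph ψ₁ ψ₂) h hdense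
  refine ⟨fun a => φ a, fun b a => (φ a < φ b ∧ ψ₁ (φ a) (φ b) = 1) ∨
    (φ b < φ a ∧ ψ₂ (φ b) (φ a) = 1 ∧ ψ₁ (φ b) (φ a) = 1), Fin.val_injective.comp hφ, ?_⟩
  intro a a' b hab hab' he hlt
  have hlt' : φ a < φ a' := hlt
  obtain ⟨x, y, z, hxy, hyz, heq, hs⟩ := mem_signGraph_edges.1 (hedge _ he)
  simp only [image_insert, image_singleton] at heq
  rcases lt_or_gt_of_ne (hφ.ne hab) with h | h
  · rcases lt_or_gt_of_ne (hφ.ne hab') with h' | h'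
    · obtain ⟨rfl, rfl, rfl⟩ := increasing_triple_unique hlt' h' hxy hyz heq
      obtain ⟨⟨h1, h2⟩, ⟨h3, h4⟩, ⟨h5, h6⟩⟩ := hs
      simp only [h5, h3, h, h', not_lt_of_gt h']
      norm_num
    · rw [pair_comm] at heq
      obtain ⟨rfl, rfl, rfl⟩ := increasing_triple_unique h h' hxy hyz heq
      obtain ⟨⟨h1, h2⟩, ⟨h3, h4⟩, ⟨h5, h6⟩⟩ := hs
      simp only [h1, h5, h6, h, h', not_lt_of_gt h']
      norm_num
  · have h' : φ b < φ a' := h.trans hlt'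
    rw [pair_comm, Finset.insert_comm] at heq
    obtain ⟨rfl, rfl, rfl⟩ := increasing_triple_unique h hlt' hxy hyz heq
    obtain ⟨⟨h1, h2⟩, ⟨h3, h4⟩, ⟨h5, h6⟩⟩ := hs
    simp only [h1, h2, h4, h, h', not_lt_of_gt h']
    norm_num

/-- Representatives can be chosen injectively from sets with at least `card ι` elements. -/
theorem exists_injective_forall_mem_of_card_le {ι W : Type*} [Fintype ι] [DecidableEq W]
    (N : ι → Finset W) (hN : ∀ b, Fintype.card ι ≤ (N b).card) :
    ∃ v : ι → W, Function.Injective v ∧ ∀ b, v b ∈ N b := by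
  refine (all_card_le_biUnion_card_iff_exists_injective N).1 fun s => ?_
  rcases s.eq_empty_or_nonempty with rfl | ⟨b, hb⟩
  · simp
  · exact (card_le_univ s).trans ((hN b).trans (card_le_card (subset_biUnion_of_mem N hb)))

theorem codeg_eq_card_subtype {n : ℕ} (H : ThreeGraph (Fin n)) {U V : Finset (Fin n)}
    (hcover : U ∪ V = univ) (hH : ∀ e ∈ H.edges, (e ∩ U).card = 2)
    (u₁ u₂ : U) :
    codeg H u₁ u₂ =
      (univ.filter fun v : V => ({↑u₁, ↑u₂, ↑v} : Finset (Fin n)) ∈ H.edges).card := by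
  rw [codeg, ← card_map (Function.Embedding.subtype _)]
  congr 1
  ext w
  simp only [mem_filter, mem_univ, true_and, mem_map, Function.Embedding.subtype_apply,
    Subtype.exists, exists_and_right, exists_eq_right]
  refine ⟨fun hw => ⟨?_, hw⟩, fun ⟨_, hw⟩ => hw⟩
  by_contra hwV
  have hwU : w ∈ U := by
    have : w ∈ U ∪ V := hcover ▸ mem_univ w
    exact (mem_union.1 this).resolve_right hwV
  have h2 := hH _ hw
  have h3 := H.card_eq _ hw
  have hsub : ({↑u₁, ↑u₂, w} : Finset (Fin n)) ⊆ U := by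
    simp [insert_subset_iff, hwU]
  rw [inter_eq_left.2 hsub] at h2
  omega


/-- For every `(2,1)`-type 3-graph `F` with vanishing uniform Turán density and every
`ε > 0` there is `m` such that every `(2,1)`-type 3-graph `H` with parts `U, V` of size at
least `m` in which every pair of distinct vertices of `U` has codegree at least `ε|V|`
contains a copy of `F`. -/
theorem stmt14 {α : Type} [Fintype α] [DecidableEq α] (F : ThreeGraph α)
    (A B : Finset α) (hdisj : Disjoint A B) (hcover : A ∪ B = Finset.univ)
    (htype : ∀ e ∈ F.edges, (e ∩ A).card = 2 ∧ (e ∩ B).card = 1)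
    (hpi : piUnif F = 0) (ε : ℝ) (hε : 0 < ε) :
    ∃ m : ℕ, ∀ (n : ℕ) (H : ThreeGraph (Fin n)) (U V : Finset (Fin n)),
      Disjoint U V → U ∪ V = Finset.univ → m ≤ U.card → m ≤ V.card →
      (∀ e ∈ H.edges, (e ∩ U).card = 2 ∧ (e ∩ V).card = 1) →
      (∀ u₁ ∈ U, ∀ u₂ ∈ U, u₁ ≠ u₂ → ε * (V.card : ℝ) ≤ (codeg H u₁ u₂ : ℝ)) →
      HasCopy H F := by

  obtain ⟨φ, S, hφ, hS⟩ := exists_order_of_piUnif_eq_zero F hpi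
  obtain ⟨k, hk⟩ : ∃ k, ∀ a, φ a < k :=
    ⟨univ.sup φ + 1, fun a => Nat.lt_succ_of_le (le_sup (mem_univ a))⟩
  obtain ⟨m, hm⟩ := exists_rich_tuple k (Fintype.card α) ε hε
  refine ⟨m, fun n H U V hUV hcov hU hV hH hcodeg => ?_⟩
  classical
  obtain ⟨u, hu, hX⟩ := hm U V (fun u₁ u₂ v => ({↑u₁, ↑u₂, ↑v} : Finset (Fin n)) ∈ H.edges)
    (by simpa using hU) (by simpa using hV) (by
      intro u₁ u₂ hne
      have := hcodeg u₁ u₁.2 u₂ u₂.2 (Subtype.coe_injective.ne hne)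
      rw [codeg_eq_card_subtype H hcov (fun e he => (hH e he).1) u₁ u₂] at this
      rw [Fintype.card_coe]
      convert this using 3
      exact filter_congr_decidable _ _ _)
  obtain ⟨v, hv, hvmem⟩ := exists_injective_forall_mem_of_card_le _
    fun b => hX fun i => decide (∃ a, φ a = i ∧ S b a)
  have hedge : ∀ a a' b, a ≠ b → a' ≠ b → ({a, a', b} : Finset α) ∈ F.edges → φ a < φ a' →
      ({↑(u (φ a)), ↑(u (φ a')), ↑(v b)} : Finset (Fin n)) ∈ H.edges := by
    intro a a' b hab hab' he hlt
    obtain ⟨h₁, h₂⟩ := hS a a' b hab hab' he hlt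
    have hvb := hvmem b
    simp only [mem_filter] at hvb
    refine hvb.2 _ (hk a) _ (hk a') hlt ?_ ?_
    · exact decide_eq_true ⟨a, rfl, h₁⟩
    · refine decide_eq_false ?_
      rintro ⟨c, hc, hSc⟩
      exact h₂ (hφ hc ▸ hSc)
  refine ⟨fun a => if a ∈ A then (u (φ a) : Fin n) else (v a : Fin n), ?_, ?_⟩
  · intro a b hab
    have hne : ∀ (x : U) (y : V), (x : Fin n) ≠ y := fun x y h =>
      disjoint_left.1 hUV x.2 (h ▸ y.2)
    by_cases ha : a ∈ A <;> by_cases hb : b ∈ A <;> simp only [ha, hb, if_true, if_false] at hab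
    · exact hφ (hu _ (hk a) _ (hk b) (Subtype.ext hab))
    · exact absurd hab (hne _ _)
    · exact absurd hab.symm (hne _ _)
    · exact hv (Subtype.ext hab)
  · intro e he
    obtain ⟨hA, hB⟩ := htype e he
    obtain ⟨a, a', haa', hA⟩ := card_eq_two.1 hA
    obtain ⟨b, hB⟩ := card_eq_one.1 hB
    have he' : e = {a, a', b} := by
      rw [← inter_univ e, ← hcover, inter_union_distrib_left, hA, hB]
      ext
      simp
    have haA : a ∈ A := (mem_inter.1 (hA ▸ mem_insert_self a _ : a ∈ e ∩ A)).2
    have haA' : a' ∈ A := (mem_inter.1 (hA ▸ by simp : a' ∈ e ∩ A)).2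
    have hbB : b ∈ B := (mem_inter.1 (hB ▸ mem_singleton_self b : b ∈ e ∩ B)).2
    have hbA : b ∉ A := fun h => disjoint_left.1 hdisj h hbB
    have hab : a ≠ b := fun h => hbA (h ▸ haA)
    have hab' : a' ≠ b := fun h => hbA (h ▸ haA')
    subst he'
    simp only [image_insert, image_singleton, haA, haA', hbA, if_true, if_false]
    rcases lt_or_gt_of_ne (hφ.ne haa') with h | h
    · exact hedge a a' b hab hab' he h
    · rw [Finset.insert_comm] at he ⊢
      exact hedge a' a b hab' hab he h
end

section
/- Let F be a 3-graph that admits a semi-layered function. Then every minimum semi-layered function of F is a layered function of F; in particular, it also satisfies condition (A3). -/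
open Finset

variable {α β : Type*}

/-- `f` is a semi-layered function of the 3-graph with edge set `E`: it satisfies
conditions (A1) and (A2). -/
def IsSemiLayeredFunction [DecidableEq α] (E : Finset (Finset α)) (f : α → ℕ) : Prop :=
  (∀ e ∈ E, ∃ w ∈ e, ∀ u ∈ e, u ≠ w → f u < f w) ∧
  (∀ e₁ ∈ E, ∀ e₂ ∈ E, e₁.sup f = e₂.sup f → Multiset.map f e₁.val = Multiset.map f e₂.val)

/-- A multiset of naturals has an element strictly larger than all the others. -/
def HasStrictMax (M : Multiset ℕ) : Prop :=
  ∃ m N, M = m ::ₘ N ∧ ∀ y ∈ N, y < m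

lemma sup_cons_of_forall_lt {m : ℕ} {N : Multiset ℕ} (h : ∀ y ∈ N, y < m) :
    (m ::ₘ N).sup = m := by
  rw [Multiset.sup_cons]
  exact sup_eq_left.2 (Multiset.sup_le.2 fun y hy => (h y hy).le)

lemma hasStrictMax_map_iff {α : Type*} [DecidableEq α] (e : Finset α) (f : α → ℕ) :
    HasStrictMax (e.val.map f) ↔ ∃ w ∈ e, ∀ u ∈ e, u ≠ w → f u < f w := by
  constructor
  · rintro ⟨m, N, hM, hN⟩
    have hm : m ∈ e.val.map f := hM ▸ Multiset.mem_cons_self m N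
    obtain ⟨w, hw, rfl⟩ := Multiset.mem_map.1 hm
    refine ⟨w, hw, fun u hu huw => hN _ ?_⟩
    rw [← Multiset.cons_erase hw, Multiset.map_cons, Multiset.cons_inj_right] at hM
    rw [← hM]
    exact Multiset.mem_map_of_mem f ((Multiset.mem_erase_of_ne huw).2 hu)
  · rintro ⟨w, hw, h⟩
    refine ⟨f w, (e.val.erase w).map f, ?_, ?_⟩
    · rw [← Multiset.map_cons, Multiset.cons_erase hw]
    · intro y hy
      obtain ⟨u, hu, rfl⟩ := Multiset.mem_map.1 hy
      have := (Multiset.Nodup.mem_erase_iff e.nodup).1 hu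
      exact h u this.2 this.1

/-- Replacing the value `c'` by a smaller value `c` changes neither the maximum nor its
strictness, unless `c'` is the maximum. -/
lemma HasStrictMax.map_lower {M : Multiset ℕ} (hM : HasStrictMax M) {c c' : ℕ} (hc : c < c')
    (hsup : M.sup ≠ c') :
    HasStrictMax (M.map fun x => if x = c' then c else x) ∧
      (M.map fun x => if x = c' then c else x).sup = M.sup := by
  obtain ⟨m, N, rfl, hN⟩ := hM
  rw [sup_cons_of_forall_lt hN] at hsup ⊢
  have hN' : ∀ y ∈ N.map (fun x => if x = c' then c else x), y < m := by
    intro y hy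
    obtain ⟨x, hx, rfl⟩ := Multiset.mem_map.1 hy
    have := hN x hx
    split_ifs <;> omega
  rw [Multiset.map_cons, if_neg hsup]
  exact ⟨⟨m, _, rfl, hN'⟩, sup_cons_of_forall_lt hN'⟩

/-- Two edges of a semi-layered function whose types differ exactly in the values `c < c'`
allow `c'` to be merged into `c`. -/
lemma IsSemiLayeredFunction.lower {α : Type*} [DecidableEq α] {E : Finset (Finset α)} {f : α → ℕ}
    (hf : IsSemiLayeredFunction E f) {e₁ e₂ : Finset α} (he₁ : e₁ ∈ E) (he₂ : e₂ ∈ E)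
    {a b c c' : ℕ} (h₁ : e₁.val.map f = {a, b, c}) (h₂ : e₂.val.map f = {a, b, c'})
    (hc : c < c') :
    IsSemiLayeredFunction E fun x => if f x = c' then c else f x := by
  set r : ℕ → ℕ := fun x => if x = c' then c else x with hr
  have hmap (e : Finset α) : e.val.map (fun x => if f x = c' then c else f x) =
      (e.val.map f).map r := by rw [Multiset.map_map]; rfl
  have hmax (e) (he : e ∈ E) : HasStrictMax (e.val.map f) :=
    (hasStrictMax_map_iff e f).2 (hf.1 e he)
  have htype (e) (he : e ∈ E) (e') (he' : e' ∈ E)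
      (h : (e.val.map f).sup = (e'.val.map f).sup) : e.val.map f = e'.val.map f :=
    hf.2 e he e' he' (by simpa only [Finset.sup_def] using h)
  have hab : a < c' ∧ b < c' := by
    have hs₁ := htype e₁ he₁ e₂ he₂
    rw [h₁, h₂] at hs₁
    have hne : ({a, b, c} : Multiset ℕ) ≠ {a, b, c'} := by
      simp [Multiset.insert_eq_cons, hc.ne]
    have hsup : max a (max b c) ≠ max a (max b c') := by
      intro h
      exact hne (hs₁ (by simpa [Multiset.insert_eq_cons] using h))
    obtain ⟨m, N, hM, hN⟩ := hmax e₂ he₂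
    have hm : m = max a (max b c') := by
      rw [← sup_cons_of_forall_lt hN, ← hM, h₂]
      simp [Multiset.insert_eq_cons]
    have hmc : m = c' := by omega
    subst hmc
    rw [h₂] at hM
    have hMN : ({a, b} : Multiset ℕ) = N := by
      rw [← Multiset.cons_inj_right m, ← hM]
      simp only [Multiset.insert_eq_cons, ← Multiset.singleton_add]
      abel
    exact ⟨hN a (by simp [← hMN]), hN b (by simp [← hMN])⟩
  have hsup₁ : (e₁.val.map f).sup ≠ c' := by
    rw [h₁]
    simp only [Multiset.insert_eq_cons, Multiset.sup_cons, Multiset.sup_singleton]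
    omega
  have hsup₂ : (e₂.val.map f).sup = c' := by
    rw [h₂]
    simp only [Multiset.insert_eq_cons, Multiset.sup_cons, Multiset.sup_singleton]
    omega
  have hrep (e) (he : e ∈ E) : ∃ e' ∈ E, (e'.val.map f).sup ≠ c' ∧
      (e.val.map f).map r = (e'.val.map f).map r := by
    by_cases h : (e.val.map f).sup = c'
    · refine ⟨e₁, he₁, hsup₁, ?_⟩
      rw [htype e he e₂ he₂ (h.trans hsup₂.symm), h₁, h₂]
      simp [hr, Multiset.insert_eq_cons]
    · exact ⟨e, he, h, rfl⟩
  refine ⟨fun e he => ?_, fun e he e' he' h => ?_⟩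
  · rw [← hasStrictMax_map_iff, hmap]
    obtain ⟨d, hd, hdc, hed⟩ := hrep e he
    rw [hed]
    exact ((hmax d hd).map_lower hc hdc).1
  · obtain ⟨d, hd, hdc, hed⟩ := hrep e he
    obtain ⟨d', hd', hdc', hed'⟩ := hrep e' he'
    rw [Finset.sup_def, Finset.sup_def, hmap, hmap, hed, hed',
      ((hmax d hd).map_lower hc hdc).2, ((hmax d' hd').map_lower hc hdc').2] at h
    rw [hmap, hmap, hed, hed', htype d hd d' hd' h]

lemma map_val_triple {α : Type*} [DecidableEq α] (f : α → ℕ) {u v w : α} (huv : u ≠ v)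
    (huw : u ≠ w) (hvw : v ≠ w) :
    ({u, v, w} : Finset α).val.map f = {f u, f v, f w} := by
  rw [Finset.insert_val_of_notMem (by simp [huv, huw]), Finset.insert_val_of_notMem (by simp [hvw])]
  simp [Multiset.insert_eq_cons]

/-- A semi-layered function of minimum cardinality (size of range) is a layered function:
it also satisfies (A3). -/
theorem stmt15 {α : Type} [Fintype α] [DecidableEq α] (F : ThreeGraph α) (f : α → ℕ)
    (hf : IsSemiLayeredFunction F.edges f)
    (hmin : ∀ g : α → ℕ, IsSemiLayeredFunction F.edges g →
      (Finset.univ.image f).card ≤ (Finset.univ.image g).card) :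
    IsLayeredFunction F.edges f := by
  have key : ∀ e₁ ∈ F.edges, ∀ e₂ ∈ F.edges, ∀ u v w u' v' w' : α,
      u ≠ v → u ≠ w → v ≠ w → u' ≠ v' → u' ≠ w' → v' ≠ w' →
      e₁ = {u, v, w} → e₂ = {u', v', w'} →
      f u = f u' → f v = f v' → ¬ f w < f w' := by
    rintro e₁ he₁ e₂ he₂ u v w u' v' w' huv huw hvw huv' huw' hvw' rfl rfl hu hv hlt
    have h₁ := map_val_triple f huv huw hvw
    have h₂ := map_val_triple f huv' huw' hvw'
    rw [← hu, ← hv] at h₂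
    refine (hmin _ (hf.lower he₁ he₂ h₁ h₂ hlt)).not_gt (Finset.card_lt_card ?_)
    refine (Finset.ssubset_iff_of_subset ?_).2 ⟨f w', Finset.mem_image_of_mem f (mem_univ _), ?_⟩
    · intro y hy
      obtain ⟨x, -, rfl⟩ := Finset.mem_image.1 hy
      split_ifs
      exacts [Finset.mem_image_of_mem f (mem_univ _), Finset.mem_image_of_mem f (mem_univ _)]
    · intro hy
      obtain ⟨x, -, hx⟩ := Finset.mem_image.1 hy
      split_ifs at hx with h
      exacts [hlt.ne hx, h hx]
  refine ⟨hf.1, hf.2, ?_⟩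
  intro e₁ he₁ e₂ he₂ u v w u' v' w' huv huw hvw huv' huw' hvw' h₁ h₂ hu hv
  exact le_antisymm
    (not_lt.1 (key e₂ he₂ e₁ he₁ u' v' w' u v w huv' huw' hvw' huv huw hvw h₂ h₁ hu.symm hv.symm))
    (not_lt.1 (key e₁ he₁ e₂ he₂ u v w u' v' w' huv huw hvw huv' huw' hvw' h₁ h₂ hu hv))
end

section
/- For any 3-graph F and any vertex v ∈ V(F), the codegree Turán densities satisfy π_co(F_v) ≤ π_co(F). -/
open Finset

variable {α β : Type*}

/-- The edges of the link graph of `v` in `F`, as 2-element subsets of the vertex set. -/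
def linkPairs [DecidableEq α] (F : ThreeGraph α) (v : α) : Finset (Finset α) :=
  (F.edges.filter (fun e => v ∈ e)).image (fun e => e.erase v)

/-- The vertex set of the linearization `F_v`: the original vertices other than `v`,
together with, for each link pair `p = {u,w}`, four new vertices `v_p, x_p, y_p, z_p`
(indexed by `Fin 4`), and three new vertices `x_v, y_v, z_v` (indexed by `Fin 3`). -/
abbrev LinVert {α : Type*} [DecidableEq α] (F : ThreeGraph α) (v : α) : Type _ :=
  {x : α // x ≠ v} ⊕ ((Fin 4 × {p : Finset α // p ∈ linkPairs F v}) ⊕ Fin 3)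

/-- `G` is the linearization `F_v` of `F` at the vertex `v`: its edges are the edges of `F`
avoiding `v`; for each link pair `p = {u,w}` of `v` the edge `{u, w, v_p}`; and for each
link pair `p` the six edges of a Fano plane minus an edge on
`{x_v, y_v, z_v, v_p, x_p, y_p, z_p}`. -/
def IsLinearization {α : Type*} [DecidableEq α] (F : ThreeGraph α) (v : α)
    (G : ThreeGraph (LinVert F v)) : Prop :=
  ∀ e : Finset (LinVert F v), e ∈ G.edges ↔
    ((∃ e₀ ∈ F.edges, v ∉ e₀ ∧ e = (e₀.subtype (fun x => x ≠ v)).image Sum.inl) ∨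
      (∃ p : {p : Finset α // p ∈ linkPairs F v},
        e = insert (Sum.inr (Sum.inl (0, p))) ((p.val.subtype (fun x => x ≠ v)).image Sum.inl) ∨
        e = {Sum.inr (Sum.inr 0), Sum.inr (Sum.inl (0, p)), Sum.inr (Sum.inl (1, p))} ∨
        e = {Sum.inr (Sum.inr 0), Sum.inr (Sum.inl (2, p)), Sum.inr (Sum.inl (3, p))} ∨
        e = {Sum.inr (Sum.inr 1), Sum.inr (Sum.inl (0, p)), Sum.inr (Sum.inl (2, p))} ∨
        e = {Sum.inr (Sum.inr 1), Sum.inr (Sum.inl (1, p)), Sum.inr (Sum.inl (3, p))} ∨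
        e = {Sum.inr (Sum.inr 2), Sum.inr (Sum.inl (0, p)), Sum.inr (Sum.inl (3, p))} ∨
        e = {Sum.inr (Sum.inr 2), Sum.inr (Sum.inl (1, p)), Sum.inr (Sum.inl (2, p))}))

/-- The finite Ramsey theorem for `k`-uniform hypergraphs, in asymmetric multicolour form. -/
theorem exists_homogeneous_subset (κ : Type) [Fintype κ] (k : ℕ) :
    ∀ g : κ → ℕ, ∃ M : ℕ, ∀ (V : Type) [DecidableEq V] (S : Finset V), M ≤ #S →
      ∀ col : Finset V → κ, ∃ c, ∃ T ⊆ S, #T = g c ∧ ∀ e ⊆ T, #e = k → col e = c := by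
  classical
  induction k with
  | zero =>
    intro g
    refine ⟨∑ c, g c, fun V _ S hS col => ?_⟩
    obtain ⟨T, hTS, hT⟩ := exists_subset_card_eq
      ((single_le_sum (fun c _ => Nat.zero_le (g c)) (mem_univ (col ∅))).trans hS)
    refine ⟨col ∅, T, hTS, hT, fun e _ he => ?_⟩
    rw [card_eq_zero.mp he]
  | succ k ihk =>
    intro g
    induction hs : ∑ c, g c generalizing g with
    | zero =>
      refine ⟨0, fun V _ S _ col => ⟨col ∅, ∅, empty_subset _, ?_, fun e he hk => ?_⟩⟩
      · exact ((sum_eq_zero_iff.mp hs) (col ∅) (mem_univ _)).symm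
      · rw [subset_empty.mp he] at hk
        simp at hk
    | succ s ihs =>
      by_cases hzero : ∃ c, g c = 0
      · obtain ⟨c, hc⟩ := hzero
        refine ⟨0, fun V _ S _ col => ⟨c, ∅, empty_subset _, by simp [hc], fun e he hk => ?_⟩⟩
        rw [subset_empty.mp he] at hk
        simp at hk
      push Not at hzero
      have hstep : ∀ c, ∑ d, Function.update g c (g c - 1) d = s := by
        intro c
        have h1 := add_sum_erase univ g (mem_univ c)
        have h2 := add_sum_erase univ (Function.update g c (g c - 1)) (mem_univ c)
        have h3 : ∑ d ∈ univ.erase c, Function.update g c (g c - 1) d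
            = ∑ d ∈ univ.erase c, g d :=
          sum_congr rfl fun d hd => Function.update_of_ne (ne_of_mem_erase hd) _ _
        have := hzero c
        simp only [Function.update_self] at h2
        omega
      choose Mc hMc using fun c => ihs _ (hstep c)
      obtain ⟨M, hM⟩ := ihk fun _ => ∑ c, Mc c
      refine ⟨M + 1, fun V _ S hS col => ?_⟩
      obtain ⟨v, hv⟩ : S.Nonempty := card_pos.mp (by omega)
      obtain ⟨c, T', hT'S, hT', hcol⟩ := hM V (S.erase v) (by rw [card_erase_of_mem hv]; omega)
        fun e => col (insert v e)
      obtain ⟨d, T, hTT', hT, hd⟩ := hMc c V T'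
        (by rw [hT']; exact single_le_sum (fun c _ => Nat.zero_le (Mc c)) (mem_univ c)) col
      have hTS : T ⊆ S.erase v := hTT'.trans hT'S
      by_cases hdc : d = c
      · subst hdc
        have hvT : v ∉ T := fun h => notMem_erase v S (hTS h)
        refine ⟨d, insert v T, insert_subset hv (hTS.trans (erase_subset _ _)), ?_, fun e he hk => ?_⟩
        · rw [card_insert_of_notMem hvT, hT, Function.update_self]
          have := hzero d
          omega
        · by_cases hve : v ∈ e
          · have := hcol (e.erase v) ((subset_insert_iff.mp he).trans hTT')
              (by rw [card_erase_of_mem hve]; omega)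
            simpa [insert_erase hve] using this
          · exact hd e ((subset_insert_iff_of_notMem hve).mp he) hk
      · refine ⟨d, T, hTS.trans (erase_subset _ _), ?_, hd⟩
        rw [hT, Function.update_of_ne hdc]

/-- If among any `L` pairs two are related by `R`, then every large ordered set contains a
quadruple in which each of the three perfect matchings consists of related pairs. -/
theorem exists_quadruple_of_forall_pairs (L : ℕ) :
    ∃ M : ℕ, ∀ (V : Type) [LinearOrder V] (R : V → V → V → V → Prop) (S : Finset V), M ≤ #S →
      (∀ p q : Fin L → V, (∀ i, p i < q i) → ∃ i j, i < j ∧ R (p i) (q i) (p j) (q j)) →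
      ∃ a ∈ S, ∃ b ∈ S, ∃ c ∈ S, ∃ d ∈ S, a < b ∧ b < c ∧ c < d ∧
        R a b c d ∧ R a c b d ∧ R a d b c := by
  classical
  obtain ⟨M, hM⟩ := exists_homogeneous_subset (Fin 3) 4 fun _ => 2 * L
  refine ⟨M, fun V _ R S hS hR => ?_⟩
  by_contra hno
  push Not at hno
  let B : Fin 3 → V → V → V → V → Prop := fun k a b c d =>
    ![¬ R a b c d, ¬ R a c b d, ¬ R a d b c] k
  have hex : ∀ e : Finset V, ∃ k : Fin 3, ∀ a ∈ S, ∀ b ∈ S, ∀ c ∈ S, ∀ d ∈ S,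
      a < b → b < c → c < d → e = {a, b, c, d} → B k a b c d := by
    intro e
    by_cases he : ∃ a ∈ S, ∃ b ∈ S, ∃ c ∈ S, ∃ d ∈ S, a < b ∧ b < c ∧ c < d ∧ e = {a, b, c, d}
    · obtain ⟨a, ha, b, hb, c, hc, d, hd, hab, hbc, hcd, he⟩ := he
      have huniq : ∀ a' b' c' d', a' < b' → b' < c' → c' < d' → e = {a', b', c', d'} →
          a' = a ∧ b' = b ∧ c' = c ∧ d' = d := by
        intro a' b' c' d' h1 h2 h3 he'
        have hcard : #e = 4 := by
          rw [he]
          rw [card_insert_of_notMem, card_insert_of_notMem, card_pair]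
          all_goals simp; try grind
        have e1 := orderEmbOfFin_unique (f := ![a, b, c, d]) hcard
          (by intro i; fin_cases i <;> simp [he])
          (by rw [Fin.strictMono_iff_lt_succ]; intro i; fin_cases i <;> simp [*])
        have e2 := orderEmbOfFin_unique (f := ![a', b', c', d']) hcard
          (by intro i; fin_cases i <;> simp [he'])
          (by rw [Fin.strictMono_iff_lt_succ]; intro i; fin_cases i <;> simp [*])
        have e3 := e2.trans e1.symm
        exact ⟨congrFun e3 0, congrFun e3 1, congrFun e3 2, congrFun e3 3⟩
      obtain ⟨k, hk⟩ : ∃ k, B k a b c d := by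
        by_cases h0 : R a b c d
        · by_cases h1 : R a c b d
          · exact ⟨2, hno a ha b hb c hc d hd hab hbc hcd h0 h1⟩
          · exact ⟨1, h1⟩
        · exact ⟨0, h0⟩
      refine ⟨k, fun a' _ b' _ c' _ d' _ h1 h2 h3 he' => ?_⟩
      obtain ⟨rfl, rfl, rfl, rfl⟩ := huniq a' b' c' d' h1 h2 h3 he'
      exact hk
    · push Not at he
      exact ⟨0, fun a ha b hb c hc d hd h1 h2 h3 h4 =>
        absurd h4 (he a ha b hb c hc d hd h1 h2 h3)⟩
  choose col hcol using hex
  obtain ⟨k, T, hTS, hT, hhom⟩ := hM V S hS col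
  let t := T.orderEmbOfFin hT
  have htS : ∀ i, t i ∈ S := fun i => hTS (orderEmbOfFin_mem T hT i)
  have key : ∀ i₁ i₂ i₃ i₄, i₁ < i₂ → i₂ < i₃ → i₃ < i₄ → B k (t i₁) (t i₂) (t i₃) (t i₄) := by
    intro i₁ i₂ i₃ i₄ h1 h2 h3
    have h1' := t.strictMono h1
    have h2' := t.strictMono h2
    have h3' := t.strictMono h3
    have hc : col {t i₁, t i₂, t i₃, t i₄} = k := by
      refine hhom _ ?_ ?_
      · simp [insert_subset_iff, t]
      · rw [card_insert_of_notMem, card_insert_of_notMem, card_pair]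
        all_goals simp; try grind
    rw [← hc]
    exact hcol _ _ (htS _) _ (htS _) _ (htS _) _ (htS _) h1' h2' h3' rfl
  fin_cases k
  · obtain ⟨i, j, hij, h⟩ := hR (fun i => t ⟨2 * i, by omega⟩) (fun i => t ⟨2 * i + 1, by omega⟩)
      fun i => t.strictMono (by simp [Fin.lt_def])
    exact key ⟨2 * i, by omega⟩ ⟨2 * i + 1, by omega⟩ ⟨2 * j, by omega⟩ ⟨2 * j + 1, by omega⟩
      (by simp) (by simp only [Fin.lt_def] at *; omega) (by simp) h
  · obtain ⟨i, j, hij, h⟩ := hR (fun i => t ⟨i, by omega⟩) (fun i => t ⟨i + L, by omega⟩)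
      fun i => t.strictMono (by simp only [Fin.lt_def]; omega)
    exact key ⟨i, by omega⟩ ⟨j, by omega⟩ ⟨i + L, by omega⟩ ⟨j + L, by omega⟩
      (by simpa using hij) (by simp only [Fin.lt_def] at *; omega)
      (by simp only [Fin.lt_def] at *; omega) h
  · obtain ⟨i, j, hij, h⟩ := hR (fun i => t ⟨i, by omega⟩) (fun i => t ⟨2 * L - 1 - i, by omega⟩)
      fun i => t.strictMono (by simp only [Fin.lt_def]; omega)
    exact key ⟨i, by omega⟩ ⟨j, by omega⟩ ⟨2 * L - 1 - j, by omega⟩ ⟨2 * L - 1 - i, by omega⟩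
      (by simpa using hij) (by simp only [Fin.lt_def] at *; omega)
      (by simp only [Fin.lt_def] at *; omega) h

/-- The set of vertices completing the pair `u, w` to an edge. -/
def coNbhd {n : ℕ} (H : ThreeGraph (Fin n)) (u w : Fin n) : Finset (Fin n) :=
  univ.filter fun a => ({u, w, a} : Finset (Fin n)) ∈ H.edges

theorem mem_coNbhd {n : ℕ} {H : ThreeGraph (Fin n)} {u w a : Fin n} :
    a ∈ coNbhd H u w ↔ ({u, w, a} : Finset (Fin n)) ∈ H.edges := by
  simp [coNbhd]

/-- Among sufficiently many dense sets, two have a dense intersection. -/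
theorem exists_lt_card_inter {n L : ℕ} (hn : 0 < n) {δ ε : ℝ} (hε : 0 ≤ ε) (hL : 3 ≤ L * δ)
    (hLε : L * L * ε ≤ 1) (A : Fin L → Finset (Fin n)) (hA : ∀ i, δ * n ≤ #(A i)) :
    ∃ i j, i < j ∧ ε * n ≤ #(A i ∩ A j) := by
  by_contra hno
  push Not at hno
  have hne : ∀ i j, i ≠ j → (#(A i ∩ A j) : ℝ) ≤ ε * n := by
    intro i j hij
    rcases lt_or_gt_of_ne hij with h | h
    · exact (hno i j h).le
    · rw [inter_comm]
      exact (hno j i h).le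
  have hn' : (0 : ℝ) < n := by exact_mod_cast hn
  have key : ∀ s : Finset (Fin L), #s * (δ * n) - #s * (L * ε * n) ≤ #(s.biUnion A) := by
    intro s
    induction s using Finset.induction_on with
    | empty => simp
    | insert i s hi ih =>
      have hsL : (#s : ℝ) ≤ L := by
        exact_mod_cast (card_le_univ s).trans_eq (Fintype.card_fin L)
      have h1 : (#(A i ∩ s.biUnion A) : ℝ) ≤ L * ε * n := by
        rw [inter_biUnion]
        calc (#(s.biUnion fun j => A i ∩ A j) : ℝ) ≤ ∑ j ∈ s, (#(A i ∩ A j) : ℝ) := by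
              exact_mod_cast card_biUnion_le
          _ ≤ ∑ j ∈ s, ε * n := sum_le_sum fun j hj => hne i j (by rintro rfl; exact hi hj)
          _ = #s * (ε * n) := by simp
          _ ≤ L * (ε * n) := by gcongr
          _ = L * ε * n := by ring
      have h2 : (#(A i ∪ s.biUnion A) : ℝ) + #(A i ∩ s.biUnion A) = #(A i) + #(s.biUnion A) := by
        exact_mod_cast card_union_add_card_inter (A i) (s.biUnion A)
      rw [biUnion_insert, card_insert_of_notMem hi]
      push_cast
      linarith [hA i]
  have h := key univ
  have hle : (#((univ : Finset (Fin L)).biUnion A) : ℝ) ≤ n := by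
    exact_mod_cast (card_le_univ _).trans_eq (Fintype.card_fin n)
  simp only [card_univ, Fintype.card_fin] at h
  nlinarith [mul_le_mul_of_nonneg_right hL hn'.le, mul_le_mul_of_nonneg_right hLε hn'.le]

/-- Some point lies in many members of a family of dense sets. -/
theorem exists_le_card_filter_mem {n : ℕ} (hn : 0 < n) {ι : Type*} {ε : ℝ} (k : ℕ)
    (J : Finset ι) (hJ : k ≤ ε * #J) (A : ι → Finset (Fin n)) (hA : ∀ j ∈ J, ε * n ≤ #(A j)) :
    ∃ a, k ≤ #{j ∈ J | a ∈ A j} := by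
  have hn' : (0 : ℝ) < n := by exact_mod_cast hn
  have : NeZero n := ⟨hn.ne'⟩
  by_contra! hno
  have hsum : ∑ a, #{j ∈ J | a ∈ A j} = ∑ j ∈ J, #(A j) := by
    simp only [card_filter]
    rw [sum_comm]
    simp
  have h1 : ∑ a, #{j ∈ J | a ∈ A j} < ∑ _a : Fin n, k :=
    sum_lt_sum_of_nonempty univ_nonempty fun a _ => hno a
  have h2 : (#J : ℝ) * (ε * n) ≤ ∑ j ∈ J, (#(A j) : ℝ) := by
    simpa using card_nsmul_le_sum J (fun j => (#(A j) : ℝ)) _ hA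
  rw [hsum] at h1
  simp only [sum_const, card_univ, Fintype.card_fin, smul_eq_mul] at h1
  have h3 : (∑ j ∈ J, (#(A j) : ℝ)) < n * k := by exact_mod_cast h1
  nlinarith

/-- Greedy extraction of pairwise disjoint quadruples. -/
theorem exists_disjoint_quadruples {V : Type*} [DecidableEq V] (P : (Fin 4 → V) → Prop) (M : ℕ)
    (hP : ∀ S : Finset V, M ≤ #S → ∃ a : Fin 4 → V, Function.Injective a ∧ (∀ i, a i ∈ S) ∧ P a)
    (K : ℕ) : ∀ S : Finset V, M + 4 * K ≤ #S → ∃ q : Fin K → Fin 4 → V,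
      (∀ j, P (q j)) ∧ (∀ j i, q j i ∈ S) ∧ ∀ j i j' i', q j i = q j' i' → j = j' ∧ i = i' := by
  induction K with
  | zero => exact fun S _ => ⟨Fin.elim0, fun j => j.elim0, fun j => j.elim0, fun j => j.elim0⟩
  | succ K ih =>
    intro S hS
    obtain ⟨a, hinj, haS, ha⟩ := hP S (by omega)
    have hsub : univ.image a ⊆ S := by
      intro x hx
      obtain ⟨i, -, rfl⟩ := mem_image.mp hx
      exact haS i
    have hcard : #(S \ univ.image a) = #S - 4 := by
      rw [card_sdiff_of_subset hsub, card_image_of_injective _ hinj]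
      simp
    obtain ⟨q, hq, hqS, hqinj⟩ := ih (S \ univ.image a) (by omega)
    have hdisj : ∀ j i i', q j i ≠ a i' := by
      intro j i i' h
      exact (mem_sdiff.mp (hqS j i)).2 (h ▸ mem_image_of_mem a (mem_univ i'))
    refine ⟨Fin.cons a q, fun j => ?_, fun j i => ?_, fun j i j' i' h => ?_⟩
    · refine Fin.cases ?_ (fun j => ?_) j
      · simpa using ha
      · simpa using hq j
    · revert i
      refine Fin.cases ?_ (fun j => ?_) j
      · simpa using haS
      · intro i
        simpa using (mem_sdiff.mp (hqS j i)).1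
    · induction j using Fin.cases with
      | zero =>
        induction j' using Fin.cases with
        | zero => exact ⟨rfl, hinj (by simpa using h)⟩
        | succ j' => exact absurd (by simpa using h.symm) (hdisj j' i' i)
      | succ j =>
        induction j' using Fin.cases with
        | zero => exact absurd (by simpa using h) (hdisj j i i')
        | succ j' =>
          obtain ⟨rfl, rfl⟩ := hqinj j i j' i' (by simpa using h)
          exact ⟨rfl, rfl⟩

/-- The three common neighbourhoods of the perfect matchings of a quadruple. -/
def matchingNbhd {n : ℕ} (H : ThreeGraph (Fin n)) (a : Fin 4 → Fin n) :
    Fin 3 → Finset (Fin n) :=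
  ![coNbhd H (a 0) (a 1) ∩ coNbhd H (a 2) (a 3), coNbhd H (a 0) (a 2) ∩ coNbhd H (a 1) (a 3),
    coNbhd H (a 0) (a 3) ∩ coNbhd H (a 1) (a 2)]

theorem exists_quadruple_dense_matchingNbhd {δ : ℝ} (hδ : 0 < δ) :
    ∃ ε : ℝ, 0 < ε ∧ ∃ M : ℕ, ∀ (n : ℕ) (H : ThreeGraph (Fin n)), 0 < n →
      (∀ u w : Fin n, u ≠ w → δ * n ≤ #(coNbhd H u w)) →
      ∀ S : Finset (Fin n), M ≤ #S → ∃ a : Fin 4 → Fin n, Function.Injective a ∧ (∀ i, a i ∈ S) ∧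
        ∀ r, ε * n ≤ #(matchingNbhd H a r) := by
  obtain ⟨L, hL⟩ := exists_nat_ge (3 / δ)
  rw [div_le_iff₀ hδ] at hL
  obtain ⟨M, hM⟩ := exists_quadruple_of_forall_pairs L
  have hL0 : (0 : ℝ) < L := by
    by_contra h
    nlinarith
  refine ⟨1 / (L * L), by positivity, M, fun n H hn hH S hS => ?_⟩
  obtain ⟨a, ha, b, hb, c, hc, d, hd, hab, hbc, hcd, h1, h2, h3⟩ := hM (Fin n)
    (fun a b c d => 1 / (L * L : ℝ) * n ≤ #(coNbhd H a b ∩ coNbhd H c d)) S hS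
    (fun p q hpq => exists_lt_card_inter hn (by positivity) hL
      (by rw [mul_one_div, div_self (by positivity)])
      (fun i => coNbhd H (p i) (q i)) fun i => hH _ _ (hpq i).ne)
  refine ⟨![a, b, c, d], ?_, ?_, ?_⟩
  · refine StrictMono.injective ?_
    rw [Fin.strictMono_iff_lt_succ]
    intro i
    fin_cases i <;> simp [*]
  · intro i
    fin_cases i <;> simp [*]
  · intro r
    fin_cases r
    · exact h1
    · exact h2
    · exact h3

theorem injective_vecCons_three {V : Type*} {x y w : V} (hyx : y ≠ x) (hwy : w ≠ y)
    (hwx : w ≠ x) : Function.Injective ![x, y, w] := by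
  intro r s h
  fin_cases r <;> fin_cases s <;> simp_all

/-- Many disjoint quadruples in a large set, completed by the same three apexes to copies of
the Fano plane minus an edge. -/
theorem exists_fano_minus_edge_family {δ : ℝ} (hδ : 0 < δ) {k : ℕ} (hk : 0 < k) (z : ℕ) :
    ∃ M N : ℕ, ∀ n, N ≤ n → ∀ H : ThreeGraph (Fin n),
      (∀ u w : Fin n, u ≠ w → δ * n ≤ #(coNbhd H u w)) →
      ∀ S Z : Finset (Fin n), M ≤ #S → #Z ≤ z →
      ∃ (q : Fin k → Fin 4 → Fin n) (X : Fin 3 → Fin n),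
        (∀ j i, q j i ∈ S) ∧ (∀ j i j' i', q j i = q j' i' → j = j' ∧ i = i') ∧
        Function.Injective X ∧ (∀ r, X r ∉ Z) ∧ (∀ r j i, X r ≠ q j i) ∧
        ∀ j r, X r ∈ matchingNbhd H (q j) r := by
  obtain ⟨ε, hε, M, hM⟩ := exists_quadruple_dense_matchingNbhd hδ
  obtain ⟨K₁, hK₁⟩ := exists_nat_ge (k / (ε / 2))
  obtain ⟨K₂, hK₂⟩ := exists_nat_ge (K₁ / (ε / 2))
  obtain ⟨K₃, hK₃⟩ := exists_nat_ge (K₂ / (ε / 2))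
  rw [div_le_iff₀' (by positivity)] at hK₁ hK₂ hK₃
  obtain ⟨N, hN⟩ := exists_nat_ge ((z + (M + 4 * K₃) + 2) / (ε / 2))
  rw [div_le_iff₀' (by positivity)] at hN
  refine ⟨M + 4 * K₃, N + 1, fun n hNn H hH S Z hS hZ => ?_⟩
  have hn : 0 < n := by omega
  obtain ⟨S', hS'S, hS'⟩ := exists_subset_card_eq hS
  obtain ⟨q, hq, hqS, hqinj⟩ := exists_disjoint_quadruples _ M (hM n H hn hH) K₃ S' hS'.ge
  have hdense : ∀ (W : Finset (Fin n)), #W ≤ z + (M + 4 * K₃) + 2 → ∀ r j,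
      ε / 2 * n ≤ #(matchingNbhd H (q j) r \ W) := by
    intro W hW r j
    have h1 : (#(matchingNbhd H (q j) r) : ℝ) ≤ #(matchingNbhd H (q j) r \ W) + #W := by
      have := le_card_sdiff W (matchingNbhd H (q j) r)
      exact_mod_cast (by omega : #(matchingNbhd H (q j) r) ≤ _)
    have h2 : (#W : ℝ) ≤ z + (M + 4 * K₃) + 2 := by exact_mod_cast hW
    have h3 : ε / 2 * (N : ℝ) ≤ ε / 2 * n := by
      gcongr
      omega
    linarith [hq j r]
  have hW₀ : #(Z ∪ S') ≤ z + (M + 4 * K₃) := (card_union_le _ _).trans (by omega)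
  obtain ⟨x, hx⟩ := exists_le_card_filter_mem hn K₂ (univ : Finset (Fin K₃)) (ε := ε / 2)
    (by simpa using hK₃) _ fun j _ => hdense (Z ∪ S') (by omega) 0 j
  set J₁ := {j ∈ (univ : Finset (Fin K₃)) | x ∈ matchingNbhd H (q j) 0 \ (Z ∪ S')}
  have hW₁ : #(insert x (Z ∪ S')) ≤ z + (M + 4 * K₃) + 1 :=
    (card_insert_le _ _).trans (by omega)
  obtain ⟨y, hy⟩ := exists_le_card_filter_mem hn K₁ J₁ (ε := ε / 2)
    (hK₂.trans (by gcongr)) _ fun j _ => hdense (insert x (Z ∪ S')) (by omega) 1 j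
  set J₂ := {j ∈ J₁ | y ∈ matchingNbhd H (q j) 1 \ (insert x (Z ∪ S'))}
  have hW₂ : #(insert y (insert x (Z ∪ S'))) ≤ z + (M + 4 * K₃) + 2 :=
    (card_insert_le _ _).trans (by omega)
  obtain ⟨w, hw⟩ := exists_le_card_filter_mem hn k J₂ (ε := ε / 2)
    (hK₁.trans (by gcongr)) _ fun j _ => hdense (insert y (insert x (Z ∪ S'))) hW₂ 2 j
  obtain ⟨J, hJ, hJk⟩ := exists_subset_card_eq hw
  let g := J.orderEmbOfFin hJk
  have hg : ∀ j, (g j ∈ univ ∧ x ∈ matchingNbhd H (q (g j)) 0 \ (Z ∪ S')) ∧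
      y ∈ matchingNbhd H (q (g j)) 1 \ (insert x (Z ∪ S')) ∧
      w ∈ matchingNbhd H (q (g j)) 2 \ (insert y (insert x (Z ∪ S'))) := by
    intro j
    have h := hJ (orderEmbOfFin_mem J hJk j)
    simp only [J₂, J₁, mem_filter] at h
    exact ⟨h.1.1, h.1.2, h.2⟩
  obtain ⟨⟨-, hx₀⟩, hy₀, hw₀⟩ := hg ⟨0, hk⟩
  simp only [mem_sdiff, mem_insert, mem_union, not_or] at hx₀ hy₀ hw₀
  have hXavoid : ∀ r, ![x, y, w] r ∉ Z ∧ ![x, y, w] r ∉ S' := by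
    intro r
    fin_cases r
    · exact hx₀.2
    · exact hy₀.2.2
    · exact hw₀.2.2.2
  refine ⟨fun j => q (g j), ![x, y, w], fun j i => hS'S (hqS _ _), ?_, ?_, fun r => (hXavoid r).1,
    fun r j i h => (hXavoid r).2 (h ▸ hqS _ _), ?_⟩
  · intro j i j' i' h
    obtain ⟨h1, h2⟩ := hqinj _ _ _ _ h
    exact ⟨g.injective h1, h2⟩
  · exact injective_vecCons_three hy₀.2.1 hw₀.2.1 hw₀.2.2.1
  · intro j r
    obtain ⟨⟨-, hx⟩, hy, hw⟩ := hg j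
    fin_cases r
    · exact (mem_sdiff.mp hx).1
    · exact (mem_sdiff.mp hy).1
    · exact (mem_sdiff.mp hw).1

/-- The 3-graph on `Fin m` induced by a map into the vertex set of `H`. -/
def pullback {m n : ℕ} (H : ThreeGraph (Fin n)) (f : Fin m → Fin n) : ThreeGraph (Fin m) where
  edges := univ.filter fun e => #e = 3 ∧ e.image f ∈ H.edges
  card_eq := fun _ he => (mem_filter.mp he).2.1

theorem card_filter_mem_coNbhd_le_codeg_pullback {m n : ℕ} (H : ThreeGraph (Fin n))
    (f : Fin m → Fin n) (i j : Fin m) :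
    #{k | f k ∈ coNbhd H (f i) (f j)} ≤ codeg (pullback H f) i j := by
  refine card_le_card fun k hk => ?_
  simp only [mem_filter, mem_univ, true_and, mem_coNbhd] at hk
  have himg : ({i, j, k} : Finset (Fin m)).image f = {f i, f j, f k} := by
    simp [image_insert]
  have hcard : #({i, j, k} : Finset (Fin m)) = 3 := by
    refine le_antisymm card_le_three ?_
    rw [← H.card_eq _ hk, ← himg]
    exact card_image_le
  simp only [pullback, mem_filter, mem_univ, true_and]
  exact ⟨hcard, by rwa [himg]⟩

/-- A product weight summed over the functions with two prescribed values. -/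
theorem sum_prod_filter_two_values_le {m n : ℕ} {i j : Fin m} (hij : i ≠ j) (u w : Fin n)
    (g : Fin n → ℝ) (hg0 : ∀ a, 0 ≤ g a) (hg1 : ∀ a, g a ≤ 1) :
    ∑ f : Fin m → Fin n with f i = u ∧ f j = w, ∏ k, g (f k) ≤ (∑ a, g a) ^ (m - 2) := by
  classical
  let h : Fin m → Fin n → ℝ := fun k a =>
    if k = i then (if a = u then 1 else 0) else if k = j then (if a = w then 1 else 0) else g a
  have hh0 : ∀ k a, 0 ≤ h k a := by
    intro k a
    simp only [h]
    split_ifs <;> first | exact hg0 a | norm_num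
  calc ∑ f : Fin m → Fin n with f i = u ∧ f j = w, ∏ k, g (f k)
      ≤ ∑ f : Fin m → Fin n with f i = u ∧ f j = w, ∏ k, h k (f k) := by
        refine sum_le_sum fun f hf => prod_le_prod (fun k _ => hg0 _) fun k _ => ?_
        obtain ⟨hu, hw⟩ := (mem_filter.mp hf).2
        simp only [h]
        split_ifs with h1 h2 h3 h4
        · exact hg1 _
        · exact absurd (h1 ▸ hu) h2
        · exact hg1 _
        · exact absurd (h3 ▸ hw) h4
        · exact le_rfl
    _ ≤ ∑ f : Fin m → Fin n, ∏ k, h k (f k) :=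
        sum_le_sum_of_subset_of_nonneg (filter_subset _ _)
          fun f _ _ => prod_nonneg fun k _ => hh0 _ _
    _ = ∏ k, ∑ a, h k a := by
        rw [prod_univ_sum, Fintype.piFinset_univ]
    _ = (∑ a, g a) ^ (m - 2) := by
        have hj : j ∈ univ.erase i := mem_erase.mpr ⟨hij.symm, mem_univ _⟩
        rw [← mul_prod_erase univ _ (mem_univ i), ← mul_prod_erase (univ.erase i) _ hj,
          prod_congr rfl (g := fun _ => ∑ a, g a)]
        · simp [h, hij.symm, card_erase_of_mem hj]
          congr 1
        · intro k hk
          simp only [mem_erase] at hk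
          simp [h, hk.1, hk.2.1]

/-- A Chernoff bound for the number of coordinates hitting a dense set. -/
theorem card_few_hits_le {m n : ℕ} {i j : Fin m} (hij : i ≠ j) (u w : Fin n) (N : Finset (Fin n))
    {x t s : ℝ} (ht : 0 ≤ t) (hN : x * n ≤ #N) :
    (#{f : Fin m → Fin n | (f i = u ∧ f j = w) ∧ (#{k | f k ∈ N} : ℝ) < s} : ℝ) ≤
      Real.exp (t * s) * (n * Real.exp (-(x * (1 - Real.exp (-t))))) ^ (m - 2) := by
  classical
  have het : Real.exp (-t) ≤ 1 := Real.exp_le_one_iff.mpr (by linarith)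
  let g : Fin n → ℝ := fun a => if a ∈ N then Real.exp (-t) else 1
  have hg0 : ∀ a, 0 ≤ g a := by
    intro a
    simp only [g]
    split_ifs <;> positivity
  have hg1 : ∀ a, g a ≤ 1 := by
    intro a
    simp only [g]
    split_ifs <;> simp [het]
  have hprod : ∀ f : Fin m → Fin n, ∏ k, g (f k) = Real.exp (-(t * #{k | f k ∈ N})) := by
    intro f
    simp only [g, prod_ite, prod_const, one_pow, mul_one]
    rw [← Real.exp_nat_mul]
    congr 1
    ring
  have hsum : ∑ a, g a ≤ n * Real.exp (-(x * (1 - Real.exp (-t)))) := by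
    have h1 : ∑ a, g a = n - #N * (1 - Real.exp (-t)) := by
      have : ∀ a, g a = 1 - (if a ∈ N then 1 - Real.exp (-t) else 0) := by
        intro a
        simp only [g]
        split_ifs <;> ring
      simp only [this, sum_sub_distrib]
      simp [mul_sub]
    have h2 := Real.add_one_le_exp (-(x * (1 - Real.exp (-t))))
    have h3 := mul_le_mul_of_nonneg_right hN (sub_nonneg.mpr het)
    have h4 := mul_le_mul_of_nonneg_left h2 (Nat.cast_nonneg (α := ℝ) n)
    rw [h1]
    linarith
  calc (#{f : Fin m → Fin n | (f i = u ∧ f j = w) ∧ (#{k | f k ∈ N} : ℝ) < s} : ℝ)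
      = ∑ f : Fin m → Fin n with (f i = u ∧ f j = w) ∧ (#{k | f k ∈ N} : ℝ) < s, (1 : ℝ) := by
        simp
    _ ≤ ∑ f : Fin m → Fin n with (f i = u ∧ f j = w) ∧ (#{k | f k ∈ N} : ℝ) < s,
          Real.exp (t * s) * ∏ k, g (f k) := by
        refine sum_le_sum fun f hf => ?_
        rw [hprod, ← Real.exp_add, Real.one_le_exp_iff]
        nlinarith [(mem_filter.mp hf).2.2]
    _ ≤ ∑ f : Fin m → Fin n with f i = u ∧ f j = w, Real.exp (t * s) * ∏ k, g (f k) := by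
        refine sum_le_sum_of_subset_of_nonneg (fun f hf => ?_) fun f _ _ =>
          mul_nonneg (Real.exp_pos _).le (prod_nonneg fun k _ => hg0 _)
        simp only [mem_filter, mem_univ, true_and] at hf ⊢
        exact hf.1
    _ ≤ Real.exp (t * s) * (n * Real.exp (-(x * (1 - Real.exp (-t))))) ^ (m - 2) := by
        rw [← mul_sum]
        gcongr
        refine (sum_prod_filter_two_values_le hij u w g hg0 hg1).trans ?_
        gcongr

/-- The maps that collapse a pair of vertices or see a small codegree there. -/
noncomputable def badMaps {m n : ℕ} (H : ThreeGraph (Fin n)) (s : ℝ) (i j : Fin m) : Finset (Fin m → Fin n) :=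
  univ.filter fun f => f i = f j ∨ (#{k | f k ∈ coNbhd H (f i) (f j)} : ℝ) < s

theorem card_badMaps_le {m n : ℕ} (hm : 2 ≤ m) (hn : 0 < n) {H : ThreeGraph (Fin n)} {x t s : ℝ}
    (ht : 0 ≤ t) (hH : ∀ u w : Fin n, u ≠ w → x * n ≤ #(coNbhd H u w)) {i j : Fin m}
    (hij : i ≠ j) :
    (#(badMaps H s i j) : ℝ) ≤ (n : ℝ) ^ m *
      (1 / n + Real.exp (t * s) * Real.exp (-(x * (1 - Real.exp (-t)))) ^ (m - 2)) := by
  classical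
  have hn' : (0 : ℝ) < n := by exact_mod_cast hn
  set E := Real.exp (t * s) * Real.exp (-(x * (1 - Real.exp (-t)))) ^ (m - 2) with hE
  have hE0 : 0 ≤ E := by positivity
  have hfib : ∀ u w : Fin n, (#{f ∈ badMaps H s i j | (f i, f j) = (u, w)} : ℝ) ≤
      (n : ℝ) ^ (m - 2) * ((if u = w then 1 else 0) + E) := by
    intro u w
    by_cases huw : u = w
    · subst huw
      have h1 := sum_prod_filter_two_values_le hij u u (fun _ => 1) (by simp) (by simp)
      simp only [prod_const_one, sum_const, card_univ, Fintype.card_fin, nsmul_eq_mul,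
        mul_one] at h1
      have h2 : (#{f ∈ badMaps H s i j | (f i, f j) = (u, u)} : ℝ) ≤
          #{f : Fin m → Fin n | f i = u ∧ f j = u} := by
        exact_mod_cast card_le_card fun f hf => by simpa using (mem_filter.mp hf).2
      refine h2.trans (h1.trans ?_)
      simp only [if_true]
      nlinarith [pow_pos hn' (m - 2)]
    · have h1 := card_few_hits_le (s := s) hij u w (coNbhd H u w) ht (hH u w huw)
      have h2 : (#{f ∈ badMaps H s i j | (f i, f j) = (u, w)} : ℝ) ≤
          #{f : Fin m → Fin n | (f i = u ∧ f j = w) ∧ (#{k | f k ∈ coNbhd H u w} : ℝ) < s} := by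
        refine Nat.cast_le.mpr (card_le_card fun f hf => ?_)
        simp only [badMaps, mem_filter, mem_univ, true_and, Prod.mk.injEq] at hf ⊢
        obtain ⟨hbad, rfl, rfl⟩ := hf
        exact ⟨⟨rfl, rfl⟩, hbad.resolve_left huw⟩
      refine h2.trans (h1.trans_eq ?_)
      rw [if_neg huw, mul_pow, hE]
      ring
  have hcard : (#(badMaps H s i j) : ℝ) =
      ∑ p : Fin n × Fin n, (#{f ∈ badMaps H s i j | (f i, f j) = p} : ℝ) := by
    exact_mod_cast card_eq_sum_card_fiberwise (s := badMaps H s i j) (t := univ)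
      (f := fun f => (f i, f j)) (fun _ _ => by simp)
  obtain ⟨l, rfl⟩ := Nat.exists_eq_add_of_le hm
  rw [hcard, Fintype.sum_prod_type]
  refine (sum_le_sum fun u _ => sum_le_sum fun w _ => hfib u w).trans_eq ?_
  simp only [← mul_sum, sum_add_distrib]
  simp
  rw [pow_add]
  field_simp

/-- For large `m` the exponential error beats the number of pairs. -/
theorem exists_large_sample {x y : ℝ} (hy : 0 ≤ y) (hxy : y < x) (n₀ : ℕ) :
    ∃ t : ℝ, 0 ≤ t ∧ ∃ m : ℕ, n₀ ≤ m ∧ 2 ≤ m ∧ (m : ℝ) ^ 2 *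
      (Real.exp (t * (y * m)) * Real.exp (-(x * (1 - Real.exp (-t)))) ^ (m - 2)) ≤ 1 / 4 := by
  obtain ⟨t, ht, hty⟩ : ∃ t : ℝ, 0 < t ∧ y * (1 + t) < x := by
    refine ⟨(x - y) / (2 * x), div_pos (by linarith) (by linarith), ?_⟩
    have hx : 0 < x := by linarith
    have : y * ((x - y) / (2 * x)) ≤ (x - y) / 2 := by
      rw [← mul_div_assoc, div_le_div_iff₀ (by linarith) (by norm_num)]
      nlinarith
    linarith
  set c := x * (1 - Real.exp (-t)) with hc
  have hcty : t * y < c := by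
    have h1 := Real.add_one_le_exp t
    have h2 : Real.exp (-t) * Real.exp t = 1 := by rw [← Real.exp_add]; simp
    have h3 := Real.exp_pos (-t)
    have h4 : t * Real.exp (-t) ≤ 1 - Real.exp (-t) := by nlinarith
    have h5 : t ≤ (1 - Real.exp (-t)) * (1 + t) := by nlinarith
    have h6 : 0 < 1 - Real.exp (-t) := by nlinarith
    have h7 : y * t ≤ y * ((1 - Real.exp (-t)) * (1 + t)) := by gcongr
    have h8 : y * (1 + t) * (1 - Real.exp (-t)) < x * (1 - Real.exp (-t)) := by gcongr
    rw [hc]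
    linarith
  have hlim : Filter.Tendsto (fun m : ℕ => Real.exp (2 * c) *
      ((m : ℝ) ^ 2 * Real.exp (-(c - t * y)) ^ m)) Filter.atTop (nhds 0) := by
    have := tendsto_pow_const_mul_const_pow_of_lt_one 2 (Real.exp_pos (-(c - t * y))).le
      (Real.exp_lt_one_iff.mpr (by linarith))
    simpa using this.const_mul (Real.exp (2 * c))
  obtain ⟨m, hm, hm₀⟩ := ((hlim.eventually_le_const (by norm_num : (0 : ℝ) < 1 / 4)).and
    (Filter.eventually_ge_atTop (n₀ + 2))).exists
  refine ⟨t, ht.le, m, by omega, by omega, le_trans (le_of_eq ?_) hm⟩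
  obtain ⟨l, rfl⟩ := Nat.exists_eq_add_of_le (show 2 ≤ m by omega)
  rw [← Real.exp_nat_mul, ← Real.exp_nat_mul, ← Real.exp_add, mul_left_comm (Real.exp (2 * c)),
    ← Real.exp_add]
  congr 2
  push_cast [Nat.add_sub_cancel_left]
  ring

/-- If `π_co(F) < x`, then in every large 3-graph with codegree density at least `x` some copy
of `F` minus the vertex `v` extends to a copy of `F` in linearly many ways. -/
theorem exists_linear_extensions {α : Type} [Fintype α] [DecidableEq α] (F : ThreeGraph α) (v : α)
    {x y : ℝ} (hy : 0 ≤ y) (hxy : y < x) (n₀ : ℕ)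
    (hF : ∀ m, n₀ ≤ m → ∀ H : ThreeGraph (Fin m),
      (∀ i j, i ≠ j → y * m ≤ (codeg H i j : ℝ)) → HasCopy H F) :
    ∃ c : ℝ, 0 < c ∧ ∃ N : ℕ, ∀ n, N ≤ n → ∀ H : ThreeGraph (Fin n),
      (∀ u w : Fin n, u ≠ w → x * n ≤ #(coNbhd H u w)) →
      ∃ (ψ : α → Fin n) (S : Finset (Fin n)), c * n ≤ #S ∧ ∀ a ∈ S,
        Function.Injective (Function.update ψ v a) ∧
        ∀ e ∈ F.edges, e.image (Function.update ψ v a) ∈ H.edges := by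
  classical
  obtain ⟨t, ht, m, hm₀, hm2, hm⟩ := exists_large_sample hy hxy n₀
  have hm' : (0 : ℝ) < m := by exact_mod_cast (by omega : 0 < m)
  refine ⟨1 / (2 * (m : ℝ) ^ Fintype.card α), by positivity, 4 * m ^ 2, fun n hn H hH => ?_⟩
  have hm2pos : 0 < m ^ 2 := by positivity
  have hn0 : 0 < n := by omega
  have hn' : (0 : ℝ) < n := by exact_mod_cast hn0
  let P : (Fin m → Fin n) → (α → Fin m) → Prop := fun f φ =>
    Function.Injective φ ∧ Function.Injective (f ∘ φ) ∧ ∀ e ∈ F.edges, e.image (f ∘ φ) ∈ H.edges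
  have hgood : ∀ f : Fin m → Fin n, (∀ i j, i ≠ j → f ∉ badMaps H (y * m) i j) → ∃ φ, P f φ := by
    intro f hf
    simp only [badMaps, mem_filter, mem_univ, true_and, not_or, not_lt] at hf
    obtain ⟨φ, hφ, hcopy⟩ := hF m hm₀ (pullback H f) fun i j hij =>
      (hf i j hij).2.trans (by exact_mod_cast card_filter_mem_coNbhd_le_codeg_pullback H f i j)
    have hfinj : Function.Injective f := fun i j h => by
      by_contra hij
      exact (hf i j hij).1 h
    refine ⟨φ, hφ, hfinj.comp hφ, fun e he => ?_⟩
    have := (mem_filter.mp (hcopy e he)).2.2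
    rwa [image_image] at this
  have hcount : (n : ℝ) ^ m / 2 ≤ #{f : Fin m → Fin n | ∃ φ, P f φ} := by
    have hcover : (univ : Finset (Fin m → Fin n)) ⊆ univ.filter (fun f => ∃ φ, P f φ) ∪
        (univ : Finset (Fin m)).offDiag.biUnion fun p => badMaps H (y * m) p.1 p.2 := by
      intro f _
      by_cases hf : ∀ i j, i ≠ j → f ∉ badMaps H (y * m) i j
      · exact mem_union_left _ (by simpa using hgood f hf)
      · push Not at hf
        obtain ⟨i, j, hij, hb⟩ := hf
        exact mem_union_right _ (mem_biUnion.mpr ⟨(i, j), by simpa using hij, hb⟩)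
    have h1 : (n : ℝ) ^ m ≤ #{f : Fin m → Fin n | ∃ φ, P f φ} +
        ∑ p ∈ (univ : Finset (Fin m)).offDiag, (#(badMaps H (y * m) p.1 p.2) : ℝ) := by
      have := (card_le_card hcover).trans
        ((card_union_le _ _).trans (Nat.add_le_add_left card_biUnion_le _))
      simp only [card_univ, Fintype.card_fun, Fintype.card_fin] at this
      exact_mod_cast this
    set E := Real.exp (t * (y * m)) * Real.exp (-(x * (1 - Real.exp (-t)))) ^ (m - 2) with hE
    have hE0 : 0 ≤ E := by positivity
    have h2 : ∑ p ∈ (univ : Finset (Fin m)).offDiag, (#(badMaps H (y * m) p.1 p.2) : ℝ) ≤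
        (m : ℝ) ^ 2 * ((n : ℝ) ^ m * (1 / n + E)) := by
      refine (sum_le_card_nsmul _ _ _ fun p hp =>
        card_badMaps_le hm2 hn0 ht hH (mem_offDiag.mp hp).2.2).trans ?_
      rw [nsmul_eq_mul]
      gcongr
      have : #(univ : Finset (Fin m)).offDiag ≤ m ^ 2 := by
        rw [offDiag_card, card_univ, Fintype.card_fin, sq]
        exact Nat.sub_le _ _
      exact_mod_cast this
    have h3 : (m : ℝ) ^ 2 * (1 / n) ≤ 1 / 4 := by
      rw [mul_one_div, div_le_div_iff₀ hn' (by norm_num)]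
      have : (4 * m ^ 2 : ℝ) ≤ n := by exact_mod_cast hn
      linarith
    nlinarith [pow_pos hn' m]
  obtain ⟨φ, hφ⟩ : ∃ φ : α → Fin m,
      (n : ℝ) ^ m / (2 * (m : ℝ) ^ Fintype.card α) ≤ #{f : Fin m → Fin n | P f φ} := by
    by_contra! hno
    have h1 : #{f : Fin m → Fin n | ∃ φ, P f φ} ≤ ∑ φ, #{f : Fin m → Fin n | P f φ} := by
      refine le_trans (card_le_card fun f hf => ?_) card_biUnion_le
      simpa using hf
    have h2 : ∑ φ, (#{f : Fin m → Fin n | P f φ} : ℝ) <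
        ∑ _φ : α → Fin m, (n : ℝ) ^ m / (2 * (m : ℝ) ^ Fintype.card α) := by
      have : Nonempty (Fin m) := ⟨⟨0, by omega⟩⟩
      exact sum_lt_sum_of_nonempty univ_nonempty fun φ _ => hno φ
    have h3 : (#{f : Fin m → Fin n | ∃ φ, P f φ} : ℝ) ≤
        ∑ φ, (#{f : Fin m → Fin n | P f φ} : ℝ) := by exact_mod_cast h1
    simp only [sum_const, card_univ, Fintype.card_fun, Fintype.card_fin, nsmul_eq_mul] at h2
    have h4 : ((m ^ Fintype.card α : ℕ) : ℝ) * ((n : ℝ) ^ m / (2 * (m : ℝ) ^ Fintype.card α)) =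
        (n : ℝ) ^ m / 2 := by
      push_cast
      field_simp
    linarith
  have hφinj : Function.Injective φ := by
    by_contra hni
    have : #{f : Fin m → Fin n | P f φ} = 0 := by
      rw [card_eq_zero, filter_eq_empty_iff]
      exact fun f _ h => hni h.1
    rw [this] at hφ
    have : 0 < (n : ℝ) ^ m / (2 * (m : ℝ) ^ Fintype.card α) := by positivity
    simp only [Nat.cast_zero] at hφ
    linarith
  let swap : (Fin m → Fin n) × Fin n → (Fin m → Fin n) × Fin n := fun p =>
    (Function.update p.1 (φ v) p.2, p.1 (φ v))
  have hswap : Function.Involutive swap := by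
    rintro ⟨f, a⟩
    simp [swap]
  have hdouble : ∑ f : Fin m → Fin n, #{a | P (Function.update f (φ v) a) φ} =
      n * #{f : Fin m → Fin n | P f φ} := by
    have h1 := Equiv.sum_comp hswap.toPerm
      (fun p : (Fin m → Fin n) × Fin n => if P p.1 φ then 1 else 0)
    simp only [Fintype.sum_prod_type] at h1
    simp only [card_filter]
    refine h1.trans ?_
    rw [mul_sum]
    refine sum_congr rfl fun f _ => ?_
    by_cases h : P f φ <;> simp [h]
  obtain ⟨f, hf⟩ : ∃ f : Fin m → Fin n, 1 / (2 * (m : ℝ) ^ Fintype.card α) * n ≤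
      #{a | P (Function.update f (φ v) a) φ} := by
    by_contra! hno
    have : Nonempty (Fin n) := ⟨⟨0, hn0⟩⟩
    have h1 : ∑ f : Fin m → Fin n, (#{a | P (Function.update f (φ v) a) φ} : ℝ) <
        ∑ _f : Fin m → Fin n, 1 / (2 * (m : ℝ) ^ Fintype.card α) * n :=
      sum_lt_sum_of_nonempty univ_nonempty fun f _ => hno f
    have h2 : ∑ f : Fin m → Fin n, (#{a | P (Function.update f (φ v) a) φ} : ℝ) =
      n * #{f : Fin m → Fin n | P f φ} := by exact_mod_cast hdouble
    rw [h2] at h1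
    simp only [sum_const, card_univ, Fintype.card_fun, Fintype.card_fin, nsmul_eq_mul] at h1
    push_cast at h1
    have h3 := mul_le_mul_of_nonneg_left hφ hn'.le
    have h4 : (n : ℝ) * ((n : ℝ) ^ m / (2 * (m : ℝ) ^ Fintype.card α)) =
      (n : ℝ) ^ m * (1 / (2 * (m : ℝ) ^ Fintype.card α) * n) := by ring
    linarith
  refine ⟨f ∘ φ, _, hf, fun a ha => ?_⟩
  obtain ⟨-, h1, h2⟩ := (mem_filter.mp ha).2
  have hcomp : Function.update f (φ v) a ∘ φ = Function.update (f ∘ φ) v a :=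
    Function.update_comp_eq_of_injective f hφinj v a
  rw [hcomp] at h1 h2
  exact ⟨h1, h2⟩

/-- Gluing: linearly many extensions of `F - v` together with a family of Fano planes minus an
edge on the extending vertices give a copy of the linearization. -/
theorem hasCopy_linearization {α : Type} [Fintype α] [DecidableEq α] {F : ThreeGraph α} {v : α}
    {G : ThreeGraph (LinVert F v)} (hG : IsLinearization F v G) {n k : ℕ} {H : ThreeGraph (Fin n)}
    (ι : {p : Finset α // p ∈ linkPairs F v} → Fin k) (hι : Function.Injective ι) (hk : 0 < k)
    {ψ : α → Fin n} {S : Finset (Fin n)}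
    (hψ : ∀ a ∈ S, Function.Injective (Function.update ψ v a) ∧
      ∀ e ∈ F.edges, e.image (Function.update ψ v a) ∈ H.edges)
    {q : Fin k → Fin 4 → Fin n} {X : Fin 3 → Fin n} (hqS : ∀ j i, q j i ∈ S)
    (hq : ∀ j i j' i', q j i = q j' i' → j = j' ∧ i = i') (hX : Function.Injective X)
    (hXψ : ∀ r u, X r ≠ ψ u) (hXq : ∀ r j i, X r ≠ q j i)
    (hfano : ∀ j r, X r ∈ matchingNbhd H (q j) r) : HasCopy H G := by
  let Φ : LinVert F v → Fin n :=
    Sum.elim (fun u => ψ u) (Sum.elim (fun s => q (ι s.2) s.1) X)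
  have hψq : ∀ u, u ≠ v → ∀ j i, ψ u ≠ q j i := by
    intro u hu j i h
    refine hu ((hψ _ (hqS j i)).1 ?_)
    rw [Function.update_of_ne hu, Function.update_self, h]
  have hψinj : ∀ u u', u ≠ v → u' ≠ v → ψ u = ψ u' → u = u' := by
    intro u u' hu hu' h
    refine (hψ _ (hqS ⟨0, hk⟩ 0)).1 ?_
    rw [Function.update_of_ne hu, Function.update_of_ne hu', h]
  have himage : ∀ (e : Finset α) (a : Fin n), v ∉ e →
      ((e.subtype (fun x => x ≠ v)).image Sum.inl : Finset (LinVert F v)).image Φ =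
        e.image (Function.update ψ v a) := by
    intro e a hve
    ext b
    simp only [mem_image, mem_subtype, Subtype.exists]
    constructor
    · rintro ⟨_, ⟨u, hu, hue, rfl⟩, rfl⟩
      exact ⟨u, hue, by simp [Φ, Function.update_of_ne hu]⟩
    · rintro ⟨u, hue, rfl⟩
      have hu : u ≠ v := fun h => hve (h ▸ hue)
      exact ⟨_, ⟨u, hu, hue, rfl⟩, by simp [Φ, Function.update_of_ne hu]⟩
  have hrot : ∀ a b c : Fin n, c ∈ coNbhd H a b → ({c, a, b} : Finset (Fin n)) ∈ H.edges := by
    intro a b c h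
    rw [mem_coNbhd] at h
    rwa [insert_comm c a, pair_comm c b]
  refine ⟨Φ, ?_, fun e he => ?_⟩
  · rintro (⟨u, hu⟩ | ⟨i, p⟩ | r) (⟨u', hu'⟩ | ⟨i', p'⟩ | r') h
    · simpa using hψinj u u' hu hu' h
    · exact absurd h (hψq u hu _ _)
    · exact absurd h.symm (hXψ r' u)
    · exact absurd h.symm (hψq u' hu' _ _)
    · obtain ⟨h1, h2⟩ := hq _ _ _ _ h
      exact congrArg (Sum.inr ∘ Sum.inl) (Prod.ext h2 (hι h1))
    · exact absurd h.symm (hXq r' _ _)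
    · exact absurd h (hXψ r u')
    · exact absurd h (hXq r _ _)
    · rw [hX h]
  rcases (hG e).mp he with ⟨e₀, he₀, hve₀, rfl⟩ | ⟨p, hp⟩
  · rw [himage e₀ (q ⟨0, hk⟩ 0) hve₀]
    exact (hψ _ (hqS _ _)).2 e₀ he₀
  have h0 := mem_inter.mp (hfano (ι p) 0)
  have h1 := mem_inter.mp (hfano (ι p) 1)
  have h2 := mem_inter.mp (hfano (ι p) 2)
  rcases hp with rfl | rfl | rfl | rfl | rfl | rfl | rfl
  · obtain ⟨e₀, he₀, hpe⟩ := mem_image.mp p.2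
    obtain ⟨he₀, hve₀⟩ := mem_filter.mp he₀
    have hvp : v ∉ p.val := hpe ▸ notMem_erase v e₀
    have hedge := (hψ _ (hqS (ι p) 0)).2 e₀ he₀
    rw [← insert_erase hve₀, image_insert, Function.update_self] at hedge
    rw [image_insert, himage p.val (q (ι p) 0) hvp, ← hpe]
    exact hedge
  · simpa [image_insert, Φ] using hrot _ _ _ h0.1
  · simpa [image_insert, Φ] using hrot _ _ _ h0.2
  · simpa [image_insert, Φ] using hrot _ _ _ h1.1
  · simpa [image_insert, Φ] using hrot _ _ _ h1.2
  · simpa [image_insert, Φ] using hrot _ _ _ h2.1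
  · simpa [image_insert, Φ] using hrot _ _ _ h2.2

/-- The linearization does not increase the codegree Turán density: `π_co(F_v) ≤ π_co(F)`. -/
theorem stmt17 {α : Type} [Fintype α] [DecidableEq α] (F : ThreeGraph α) (v : α)
    (G : ThreeGraph (LinVert F v)) (hG : IsLinearization F v G) :
    piCo G ≤ piCo F := by
  have hpi0 : 0 ≤ piCo F := Real.sSup_nonneg fun x hx => hx.1
  refine Real.sSup_le (fun x hx => ?_) hpi0
  obtain ⟨hx0, hx1, hx⟩ := hx
  by_contra! hlt
  obtain ⟨y, hy, hyx⟩ := exists_between hlt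
  have hy0 : 0 ≤ y := hpi0.trans hy.le
  have hyF : ¬ (0 ≤ y ∧ y ≤ 1 ∧ ∀ n₀ : ℕ, ∃ n : ℕ, n₀ ≤ n ∧ ∃ H : ThreeGraph (Fin n),
      ¬ HasCopy H F ∧ ∀ u v : Fin n, u ≠ v → y * n ≤ (codeg H u v : ℝ)) := fun h =>
    hy.not_ge (le_csSup ⟨1, fun _ hz => hz.2.1⟩ h)
  push Not at hyF
  obtain ⟨n₀, hn₀⟩ := hyF hy0 (hyx.le.trans hx1)
  have hF : ∀ m, n₀ ≤ m → ∀ H : ThreeGraph (Fin m),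
      (∀ i j, i ≠ j → y * m ≤ (codeg H i j : ℝ)) → HasCopy H F := by
    intro m hm H hH
    by_contra hcopy
    obtain ⟨i, j, hij, hlt⟩ := hn₀ m hm H hcopy
    exact (hH i j hij).not_gt hlt
  obtain ⟨c, hc, N₁, hN₁⟩ := exists_linear_extensions F v hy0 hyx n₀ hF
  let k := Fintype.card {p : Finset α // p ∈ linkPairs F v} + 1
  obtain ⟨M, N₂, hN₂⟩ := exists_fano_minus_edge_family (hy0.trans_lt hyx)
    (k := k) (Nat.succ_pos _) (Fintype.card α)
  obtain ⟨N₃, hN₃⟩ := exists_nat_ge (M / c)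
  rw [div_le_iff₀' hc] at hN₃
  obtain ⟨n, hn, H, hfree, hH⟩ := hx (max N₁ (max N₂ N₃))
  simp only [max_le_iff] at hn
  obtain ⟨ψ, S, hS, hψ⟩ := hN₁ n hn.1 H hH
  have hMS : M ≤ #S := by
    have : c * (N₃ : ℝ) ≤ c * n := by
      gcongr
      exact hn.2.2
    exact_mod_cast hN₃.trans (this.trans hS)
  obtain ⟨q, X, hqS, hq, hX, hXZ, hXq, hfano⟩ :=
    hN₂ n hn.2.1 H hH S (univ.image ψ) hMS (card_image_le.trans_eq card_univ)
  refine hfree (hasCopy_linearization hG (fun p => (Fintype.equivFin _ p).castSucc)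
    ((Fin.castSucc_injective _).comp (Fintype.equivFin _).injective) (Nat.succ_pos _) hψ hqS hq hX
    (fun r u h => hXZ r (h ▸ mem_image_of_mem ψ (mem_univ u))) hXq hfano)
end

section
/- Let F be the 3-graph with vertex set {a,b,c,d,e,f,g,h,i,j,k,ℓ} and edge set {abc, abd, cde, fgh, fgi, hij, hik, jkℓ, ehℓ}. Then π_co(F) ≥ 1/12. -/
open Finset

variable {α β : Type*}

/-- A totally symmetric quasigroup operation on twelve elements such that `x ∘ (x² ∘ x²)` is never
a square, where `x² = x ∘ x`. -/
def quasigroupOp : Fin 12 → Fin 12 → Fin 12 :=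
  ![![1, 0, 8, 3, 5, 4, 11, 10, 2, 9, 7, 6],
    ![0, 2, 1, 5, 9, 3, 7, 6, 10, 4, 8, 11],
    ![8, 1, 3, 2, 11, 10, 6, 9, 0, 7, 5, 4],
    ![3, 5, 2, 0, 10, 1, 9, 7, 11, 6, 4, 8],
    ![5, 9, 11, 10, 7, 0, 8, 4, 6, 1, 3, 2],
    ![4, 3, 10, 1, 0, 6, 5, 11, 9, 8, 2, 7],
    ![11, 7, 6, 9, 8, 5, 2, 1, 4, 3, 10, 0],
    ![10, 6, 9, 7, 4, 11, 1, 3, 8, 2, 0, 5],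
    ![2, 10, 0, 11, 6, 9, 4, 8, 7, 5, 1, 3],
    ![9, 4, 7, 6, 1, 8, 3, 2, 5, 0, 11, 10],
    ![7, 8, 5, 4, 3, 2, 10, 0, 1, 11, 6, 9],
    ![6, 11, 4, 8, 2, 7, 0, 5, 3, 10, 9, 1]]

lemma quasigroupOp_comm (x y : Fin 12) : quasigroupOp x y = quasigroupOp y x := by
  decide +revert

lemma quasigroupOp_quasigroupOp (x y : Fin 12) : quasigroupOp x (quasigroupOp x y) = y := by
  decide +revert

lemma quasigroupOp_ne_square (c h : Fin 12) :
    quasigroupOp h (quasigroupOp (quasigroupOp h h) (quasigroupOp h h)) ≠ quasigroupOp c c := by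
  decide +revert

/-- The 3-graph whose edges are the triples of vertices with colours `x`, `y` and `x ∘ y`. -/
noncomputable def colourGraph {V : Type*} [Fintype V] [DecidableEq V] (col : V → Fin 12) :
    ThreeGraph V where
  edges := {e ∈ powersetCard 3 univ |
    ∃ u v w, e = {u, v, w} ∧ quasigroupOp (col u) (col v) = col w}
  card_eq _ he := (mem_powersetCard.1 (mem_filter.1 he).1).2

section colourGraph

variable {V : Type*} [Fintype V] [DecidableEq V] {col : V → Fin 12} {u v w : V}

lemma mem_edges_colourGraph (huv : u ≠ v) (huw : u ≠ w) (hvw : v ≠ w) :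
    {u, v, w} ∈ (colourGraph col).edges ↔ quasigroupOp (col u) (col v) = col w := by
  have hcard : ({u, v, w} : Finset V).card = 3 := card_eq_three.2 ⟨u, v, w, huv, huw, hvw, rfl⟩
  simp only [colourGraph, mem_filter, mem_powersetCard, subset_univ, hcard, true_and]
  refine ⟨?_, fun h ↦ ⟨u, v, w, rfl, h⟩⟩
  rintro ⟨u', v', w', he, h⟩
  have hmem (x : V) : x = u ∨ x = v ∨ x = w ↔ x = u' ∨ x = v' ∨ x = w' := by
    simpa using Finset.ext_iff.1 he x
  have hu := (hmem u).1 (by simp)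
  have hv := (hmem v).1 (by simp)
  have hw := (hmem w).1 (by simp)
  have := quasigroupOp_comm
  have := quasigroupOp_quasigroupOp
  grind

lemma quasigroupOp_col_eq_of_image_mem {α : Type*} [DecidableEq α] {φ : α → V}
    (hφ : Function.Injective φ) {a b c : α} (hab : a ≠ b) (hac : a ≠ c) (hbc : b ≠ c)
    (h : ({a, b, c} : Finset α).image φ ∈ (colourGraph col).edges) :
    quasigroupOp (col (φ a)) (col (φ b)) = col (φ c) := by
  rw [image_insert, image_insert, image_singleton] at h
  exact (mem_edges_colourGraph (hφ.ne hab) (hφ.ne hac) (hφ.ne hbc)).1 h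

lemma not_hasCopy_colourGraph (F : ThreeGraph (Fin 12))
    (hF : F.edges =
      ({({0, 1, 2} : Finset (Fin 12)), {0, 1, 3}, {2, 3, 4}, {5, 6, 7}, {5, 6, 8},
        {7, 8, 9}, {7, 8, 10}, {9, 10, 11}, {4, 7, 11}} : Finset (Finset (Fin 12)))) :
    ¬ HasCopy (colourGraph col) F := by
  rintro ⟨φ, hφ, hE⟩
  have key (a b c : Fin 12) (hab : a ≠ b) (hac : a ≠ c) (hbc : b ≠ c) (h : {a, b, c} ∈ F.edges) :
      quasigroupOp (col (φ a)) (col (φ b)) = col (φ c) :=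
    quasigroupOp_col_eq_of_image_mem hφ hab hac hbc (hE _ h)
  have abc := key 0 1 2 (by decide) (by decide) (by decide) (by simp [hF])
  have abd := key 0 1 3 (by decide) (by decide) (by decide) (by simp [hF])
  have cde := key 2 3 4 (by decide) (by decide) (by decide) (by simp [hF])
  have fgh := key 5 6 7 (by decide) (by decide) (by decide) (by simp [hF])
  have fgi := key 5 6 8 (by decide) (by decide) (by decide) (by simp [hF])
  have hij := key 7 8 9 (by decide) (by decide) (by decide) (by simp [hF])
  have hik := key 7 8 10 (by decide) (by decide) (by decide) (by simp [hF])
  have jkl := key 9 10 11 (by decide) (by decide) (by decide) (by simp [hF])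
  have ehl := key 4 7 11 (by decide) (by decide) (by decide) (by simp [hF])
  have hl : quasigroupOp (col (φ 7)) (col (φ 11)) = col (φ 4) := by
    rw [← ehl, quasigroupOp_comm (col (φ 4)), quasigroupOp_quasigroupOp]
  rw [← abd, abc] at cde
  rw [← fgi, fgh] at hij hik
  rw [← hij, ← hik] at jkl
  rw [← jkl, ← cde] at hl
  exact quasigroupOp_ne_square _ _ hl

/-- The codegree of two vertices is at least the size of a colour class, up to the two vertices. -/
lemma card_colour_le_codeg (huv : u ≠ v) :
    #{w | col w = quasigroupOp (col u) (col v)} ≤ codeg (colourGraph col) u v + 2 := by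
  have hsub : ({w | col w = quasigroupOp (col u) (col v)} : Finset V) ⊆
      univ.filter (fun w ↦ {u, v, w} ∈ (colourGraph col).edges) ∪ {u, v} := by
    intro w hw
    by_cases huw : u = w
    · simp [huw]
    by_cases hvw : v = w
    · simp [hvw]
    refine mem_union_left _ (mem_filter.2 ⟨mem_univ w, ?_⟩)
    exact (mem_edges_colourGraph huv huw hvw).2 (mem_filter.1 hw).2.symm
  calc _ ≤ _ := card_le_card hsub
    _ ≤ _ := card_union_le _ _
    _ ≤ _ := Nat.add_le_add_left card_le_two _

end colourGraph

lemma le_card_filter_modNat (k : ℕ) (z : Fin 12) :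
    k ≤ #{w : Fin (k * 12) | w.modNat = z} := by
  calc k = #(univ.image fun i : Fin k ↦ finProdFinEquiv (i, z)) := by
        rw [card_image_of_injective, card_univ, Fintype.card_fin]
        intro i j h
        simpa using h
    _ ≤ _ := card_le_card fun w hw ↦ by
        obtain ⟨i, -, rfl⟩ := mem_image.1 hw
        refine mem_filter.2 ⟨mem_univ _, ?_⟩
        exact congrArg Prod.snd (finProdFinEquiv.symm_apply_apply (i, z))

/-- The 3-graph on vertices `a,b,c,d,e,f,g,h,i,j,k,ℓ` (identified with `0,…,11`) with
edges `abc, abd, cde, fgh, fgi, hij, hik, jkℓ, ehℓ` has codegree Turán density at least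
`1/12`. -/
theorem stmt18 (F : ThreeGraph (Fin 12))
    (hF : F.edges =
      ({({0, 1, 2} : Finset (Fin 12)), {0, 1, 3}, {2, 3, 4}, {5, 6, 7}, {5, 6, 8},
        {7, 8, 9}, {7, 8, 10}, {9, 10, 11}, {4, 7, 11}} : Finset (Finset (Fin 12)))) :
    1 / 12 ≤ piCo F := by
  refine le_of_forall_lt fun x hx ↦ ?_
  obtain ⟨y, hxy, hy⟩ := exists_between (max_lt hx (by norm_num : (0 : ℝ) < 1 / 12))
  obtain ⟨hxy, hy0⟩ := max_lt_iff.1 hxy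
  refine hxy.trans_le (le_csSup ⟨1, fun _ h ↦ h.2.1⟩ ⟨hy0.le, by linarith, fun n₀ ↦ ?_⟩)
  obtain ⟨k, hk⟩ := exists_nat_ge (2 / (1 - 12 * y))
  have hk' : 2 ≤ ((max k n₀ : ℕ) : ℝ) * (1 - 12 * y) := by
    rw [← div_le_iff₀ (by linarith)]
    exact hk.trans (by exact_mod_cast le_max_left k n₀)
  refine ⟨max k n₀ * 12, by omega, colourGraph Fin.modNat, not_hasCopy_colourGraph F hF,
    fun u v huv ↦ ?_⟩
  have hcodeg : ((max k n₀ : ℕ) : ℝ) ≤ codeg (colourGraph Fin.modNat) u v + 2 := by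
    exact_mod_cast (le_card_filter_modNat _ _).trans (card_colour_le_codeg huv)
  rw [Nat.cast_mul]
  push_cast at hcodeg hk' ⊢
  linarith
end

section
/- Let k ≥ 4 and n be positive integers, and let every 2-element subset of {1,…,n} be colored red or blue. Let H be the 3-graph on vertex set {1,…,n} whose edges are exactly the triples r < s < t such that the pairs {r,s} and {r,t} are red and the pair {s,t} is blue. Then H is F̃_k-free. -/
open Finset

variable {α β : Type*}

/-- The collection of all 3-graphs (given by their edge sets) on vertex set `Fin k`
with minimum codegree at least `2`. -/
abbrev CodegTwoFamily (k : ℕ) : Type :=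
  {E : Finset (Finset (Fin k)) //
    (∀ e ∈ E, e.card = 3) ∧
    ∀ u v : Fin k, u ≠ v →
      2 ≤ (Finset.univ.filter (fun w => ({u, v, w} : Finset (Fin k)) ∈ E)).card}

noncomputable instance (k : ℕ) : Fintype (CodegTwoFamily k) := Fintype.ofFinite _

/-- The tensor product `F̃_k` of all 3-graphs on `{1, …, k}` with minimum codegree at
least two: vertices are tuples (functions on the index family), and three vertices form
an edge iff their coordinates form an edge in every member of the family. -/
noncomputable def tensorGraph (k : ℕ) : ThreeGraph (CodegTwoFamily k → Fin k) where
  edges := Finset.univ.filter (fun e : Finset (CodegTwoFamily k → Fin k) =>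
    e.card = 3 ∧ ∀ i : CodegTwoFamily k, e.image (fun x => x i) ∈ i.val)
  card_eq := fun e he => (Finset.mem_filter.mp he).2.1

/-- For `k ≥ 4` the complete 3-graph on `Fin k` has minimum codegree at least two. -/
lemma codegTwoFamily_nonempty {k : ℕ} (hk : 4 ≤ k) : Nonempty (CodegTwoFamily k) := by
  refine ⟨⟨univ.filter fun e => e.card = 3, by simp, fun u v huv => ?_⟩⟩
  have hsub : (univ \ {u, v} : Finset (Fin k)) ⊆
      univ.filter fun w => ({u, v, w} : Finset (Fin k)) ∈ univ.filter fun e => e.card = 3 := by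
    intro w hw
    simp only [mem_sdiff, mem_univ, true_and, mem_insert, mem_singleton, not_or] at hw
    simp only [mem_filter, mem_univ, true_and]
    exact card_eq_three.2 ⟨u, v, w, huv, Ne.symm hw.1, Ne.symm hw.2, rfl⟩
  have hcard := le_card_sdiff ({u, v} : Finset (Fin k)) univ
  rw [card_pair huv, card_univ, Fintype.card_fin] at hcard
  have := card_le_card hsub
  omega

/-- In a member of the family, every pair extends to an edge whose third vertex avoids any
prescribed vertex. -/
lemma CodegTwoFamily.exists_edge_ne {k : ℕ} (i : CodegTwoFamily k) {u v : Fin k} (huv : u ≠ v)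
    (a : Fin k) : ∃ w, w ≠ a ∧ ({u, v, w} : Finset (Fin k)) ∈ i.val := by
  obtain ⟨w, hw, hwa⟩ := exists_mem_ne (i.2.2 u v huv) a
  exact ⟨w, hwa, (mem_filter.1 hw).2⟩

/-- Tuples forming an edge in every coordinate form an edge of the tensor product. -/
lemma mem_tensorGraph_edges {k : ℕ} [DecidableEq (CodegTwoFamily k → Fin k)]
    [Nonempty (CodegTwoFamily k)]
    {x y z : CodegTwoFamily k → Fin k}
    (h : ∀ i, ({x i, y i, z i} : Finset (Fin k)) ∈ i.val) :
    ({x, y, z} : Finset (CodegTwoFamily k → Fin k)) ∈ (tensorGraph k).edges := by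
  have himage : ∀ i : CodegTwoFamily k,
      ({x, y, z} : Finset (CodegTwoFamily k → Fin k)).image (fun x => x i) = {x i, y i, z i} := by
    simp [image_insert]
  refine mem_filter.2 ⟨mem_univ _, le_antisymm card_le_three ?_, fun i => himage i ▸ h i⟩
  obtain ⟨i⟩ := ‹Nonempty (CodegTwoFamily k)›
  rw [← i.2.1 _ (h i), ← himage i]
  exact card_image_le

/-- In the 3-graph of a coloring, an edge with least vertex `x` has red pairs at `x` and a blue
opposite pair. -/
lemma color_of_least {n : ℕ} {c : Sym2 (Fin n) → Bool} {x y z r s t : Fin n}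
    (hxy : x < y) (hxz : x < z) (hrs : r < s) (hst : s < t)
    (he : ({x, y, z} : Finset (Fin n)) = {r, s, t})
    (crs : c s(r, s) = true) (crt : c s(r, t) = true) (cst : c s(s, t) = false) :
    c s(x, y) = true ∧ c s(y, z) = false := by
  simp only [Finset.ext_iff, mem_insert, mem_singleton] at he
  obtain rfl : x = r := by have := he x; have := he r; grind
  have hcases : y = s ∧ z = t ∨ y = t ∧ z = s := by
    have := he s; have := he t; grind
  obtain ⟨rfl, rfl⟩ | ⟨rfl, rfl⟩ := hcases
  · exact ⟨crs, cst⟩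
  · exact ⟨crt, Sym2.eq_swap ▸ cst⟩

/-- If the pairs of `{1, …, n}` are colored red (`true`) or blue (`false`), and `H` is the
3-graph whose edges are exactly the triples `r < s < t` with `{r,s}`, `{r,t}` red and
`{s,t}` blue, then `H` contains no copy of `F̃_k`, for any `k ≥ 4`. -/
theorem stmt19 (k n : ℕ) (hk : 4 ≤ k) (c : Sym2 (Fin n) → Bool) (H : ThreeGraph (Fin n))
    (hH : ∀ e : Finset (Fin n), e ∈ H.edges ↔
      ∃ r s t : Fin n, r < s ∧ s < t ∧ e = {r, s, t} ∧
        c s(r, s) = true ∧ c s(r, t) = true ∧ c s(s, t) = false) :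
    ¬ HasCopy H (tensorGraph k) := by
  classical
  rintro ⟨φ, hφ, hedge⟩
  have : Nonempty (CodegTwoFamily k) := codegTwoFamily_nonempty hk
  have : Nontrivial (Fin k) := Fin.nontrivial_iff_two_le.2 (by omega)
  have hcolor : ∀ x y z : CodegTwoFamily k → Fin k,
      (∀ i, ({x i, y i, z i} : Finset (Fin k)) ∈ i.val) → φ x < φ y → φ x < φ z →
      c s(φ x, φ y) = true ∧ c s(φ y, φ z) = false := by
    intro x y z h hxy hxz
    have hmem := hedge _ (mem_tensorGraph_edges h)
    simp only [image_insert, image_singleton] at hmem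
    obtain ⟨r, s, t, hrs, hst, he, crs, crt, cst⟩ := (hH _).1 hmem
    exact color_of_least hxy hxz hrs hst he crs crt cst
  have hlt : ∀ x y : CodegTwoFamily k → Fin k, φ x ≤ φ y → (∃ i, x i ≠ y i) → φ x < φ y :=
    fun x y hle ⟨i, hi⟩ => hle.lt_of_ne fun h => hi (congrFun (hφ h) i)
  obtain ⟨i₀⟩ := ‹Nonempty (CodegTwoFamily k)›
  -- `v` is the least vertex, and `s` the least one differing from `v` in every coordinate.
  obtain ⟨v, -, hv⟩ := exists_min_image univ φ univ_nonempty
  choose s₀ hs₀ using fun i => exists_ne (v i)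
  obtain ⟨s, hs, hsmin⟩ := exists_min_image (univ.filter fun x => ∀ i, x i ≠ v i) φ
    ⟨s₀, by simpa using hs₀⟩
  simp only [mem_filter, mem_univ, true_and] at hs hsmin
  choose t htv ht using fun i : CodegTwoFamily k => i.exists_edge_ne (hs i).symm (v i)
  have hts : ∀ i, s i ≠ t i := by
    intro i h
    have hcard := i.2.1 _ (ht i)
    rw [h, pair_eq_singleton] at hcard
    have := card_le_two (a := v i) (b := t i)
    omega
  choose u huv hu using fun i : CodegTwoFamily k => i.exists_edge_ne (hts i) (v i)
  have hus : ∀ i, s i ≠ u i := by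
    intro i h
    have hcard := i.2.1 _ (hu i)
    rw [← h, pair_comm, insert_eq_of_mem (by simp)] at hcard
    have := card_le_two (a := s i) (b := t i)
    omega
  have hred := (hcolor s t u hu (hlt s t (hsmin t htv) ⟨i₀, hts i₀⟩)
    (hlt s u (hsmin u huv) ⟨i₀, hus i₀⟩)).1
  have hblue := (hcolor v s t ht (hlt v s (hv s (mem_univ s)) ⟨i₀, (hs i₀).symm⟩)
    (hlt v t (hv t (mem_univ t)) ⟨i₀, (htv i₀).symm⟩)).2
  simp [hred] at hblue
end
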